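/- arXiv:1805.02323 — 2 statements merged into one kernel-verified Lean document; each statement's English description precedes it below -/
import Mathlib

section
/- Rearrangement bound for the logarithmic energy: let λ, κ, ε > 0 with λπε² = κ, and let ω : ℝ² → ℝ be measurable with 0 ≤ ω ≤ λ almost everywhere, ω = 0 almost everywhere outside some compact set, and ∫_{ℝ²} ω = κ. Then ∫_{ℝ²}∫_{ℝ²} ln(1/|x−y|)·ω(x)ω(y) dx dy ≤ λ²·∫_{B_ε(0)}∫_{B_ε(0)} ln(1/|x−y|) dx dy. -/
open MeasureTheory Metric Real Filter Topology

noncomputable section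

abbrev E2 := EuclideanSpace ℝ (Fin 2)

section Polarization

variable {E : Type*} [NormedAddCommGroup E] [InnerProductSpace ℝ E]

/-- The signed distance from `x` to the hyperplane `⟪u, ·⟫ = c`, positive on the side of the
origin when `0 < c`. -/
def sideOf (u : E) (c : ℝ) (x : E) : ℝ := c - inner ℝ u x

/-- The reflection across the hyperplane `⟪u, ·⟫ = c`, where `u` is a unit vector. -/
def hyperplaneReflection (u : E) (c : ℝ) (x : E) : E := x + (2 * sideOf u c x) • u

/-- The polarization of `f` with respect to the half-space `0 ≤ sideOf u c`. -/
def polarization (u : E) (c : ℝ) (f : E → ℝ) (x : E) : ℝ :=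
  if 0 ≤ sideOf u c x then max (f x) (f (hyperplaneReflection u c x))
  else min (f x) (f (hyperplaneReflection u c x))

variable {u : E} {c : ℝ}

lemma sideOf_reflection (hu : ‖u‖ = 1) (x : E) :
    sideOf u c (hyperplaneReflection u c x) = -sideOf u c x := by
  simp only [sideOf, hyperplaneReflection, inner_add_right, real_inner_smul_right,
    real_inner_self_eq_norm_sq, hu]
  ring

lemma reflection_involutive (hu : ‖u‖ = 1) :
    Function.Involutive (hyperplaneReflection u c) := fun x => by
  rw [hyperplaneReflection, sideOf_reflection hu, hyperplaneReflection, add_assoc, ← add_smul]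
  simp

lemma reflection_eq_self {x : E} (hx : sideOf u c x = 0) : hyperplaneReflection u c x = x := by
  simp [hyperplaneReflection, hx]

lemma hyperplaneReflection_eq (hu : ‖u‖ = 1) (x : E) :
    hyperplaneReflection u c x = (ℝ ∙ u)ᗮ.reflection x + (2 * c) • u := by
  rw [Submodule.reflection_orthogonal_apply, Submodule.reflection_singleton_apply, hu,
    hyperplaneReflection, sideOf]
  simp only [RCLike.ofReal_real_eq_id, id, one_pow, div_one]
  module

lemma dist_reflection_reflection (hu : ‖u‖ = 1) (x y : E) :
    dist (hyperplaneReflection u c x) (hyperplaneReflection u c y) = dist x y := by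
  simp only [hyperplaneReflection_eq hu, dist_add_right, LinearIsometryEquiv.dist_map]

lemma isometry_hyperplaneReflection (hu : ‖u‖ = 1) : Isometry (hyperplaneReflection u c) :=
  Isometry.of_dist_eq (dist_reflection_reflection hu)

lemma dist_reflection_left (hu : ‖u‖ = 1) (x y : E) :
    dist (hyperplaneReflection u c x) y = dist x (hyperplaneReflection u c y) := by
  rw [← dist_reflection_reflection (c := c) hu x, reflection_involutive hu]

lemma dist_reflection_right_sq (hu : ‖u‖ = 1) (x y : E) :
    dist x (hyperplaneReflection u c y) ^ 2 = dist x y ^ 2 + 4 * sideOf u c x * sideOf u c y := by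
  rw [dist_eq_norm, dist_eq_norm, hyperplaneReflection, ← sub_sub, norm_sub_sq_real (x - y),
    norm_smul, hu, real_inner_smul_right, inner_sub_left, real_inner_comm u x, real_inner_comm u y,
    mul_one, Real.norm_eq_abs, sq_abs]
  simp only [sideOf]
  ring

lemma norm_reflection_sq (hu : ‖u‖ = 1) (x : E) :
    ‖hyperplaneReflection u c x‖ ^ 2 = ‖x‖ ^ 2 + 4 * c * sideOf u c x := by
  have h := dist_reflection_right_sq (c := c) hu 0 x
  simpa [sideOf] using h

lemma dist_le_dist_reflection (hu : ‖u‖ = 1) {x y : E} (h : 0 ≤ sideOf u c x * sideOf u c y) :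
    dist x y ≤ dist x (hyperplaneReflection u c y) := by
  refine le_of_sq_le_sq ?_ dist_nonneg
  rw [dist_reflection_right_sq hu]
  nlinarith

lemma dist_reflection_le_dist (hu : ‖u‖ = 1) {x y : E} (h : sideOf u c x * sideOf u c y ≤ 0) :
    dist x (hyperplaneReflection u c y) ≤ dist x y := by
  refine le_of_sq_le_sq ?_ dist_nonneg
  rw [dist_reflection_right_sq hu]
  nlinarith

lemma norm_le_norm_reflection (hu : ‖u‖ = 1) (hc : 0 ≤ c) {x : E} (hx : 0 ≤ sideOf u c x) :
    ‖x‖ ≤ ‖hyperplaneReflection u c x‖ := by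
  refine le_of_sq_le_sq ?_ (norm_nonneg _)
  rw [norm_reflection_sq hu]
  nlinarith [mul_nonneg hc hx]

/-- Two distinct points are exchanged by the reflection across their perpendicular bisector. -/
lemma exists_reflection_eq {x y : E} (hxy : x ≠ y) (h : ‖x‖ ≤ ‖y‖) :
    ∃ (u : E) (c : ℝ), ‖u‖ = 1 ∧ 0 ≤ c ∧ (‖x‖ < ‖y‖ → 0 < c) ∧ 0 < sideOf u c x ∧
      hyperplaneReflection u c x = y := by
  have hd : 0 < ‖y - x‖ := norm_pos_iff.2 (sub_ne_zero.2 hxy.symm)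
  have hsq := norm_sub_sq_real y x
  have hside : sideOf (‖y - x‖⁻¹ • (y - x)) ((‖y‖ ^ 2 - ‖x‖ ^ 2) / (2 * ‖y - x‖)) x
      = ‖y - x‖ / 2 := by
    rw [sideOf, real_inner_smul_left, inner_sub_left, real_inner_self_eq_norm_sq]
    field_simp
    linarith
  refine ⟨‖y - x‖⁻¹ • (y - x), (‖y‖ ^ 2 - ‖x‖ ^ 2) / (2 * ‖y - x‖), ?_, ?_, ?_, ?_, ?_⟩
  · rw [norm_smul, norm_inv, norm_norm, inv_mul_cancel₀ hd.ne']
  · have : ‖x‖ ^ 2 ≤ ‖y‖ ^ 2 := by gcongr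
    exact div_nonneg (by linarith) (by positivity)
  · intro hlt
    have : ‖x‖ ^ 2 < ‖y‖ ^ 2 := by gcongr
    exact div_pos (by linarith) (by positivity)
  · rw [hside]; positivity
  · rw [hyperplaneReflection, hside, smul_smul, mul_div_cancel₀ _ two_ne_zero,
      mul_inv_cancel₀ hd.ne', one_smul, add_sub_cancel]

variable {f : E → ℝ}

lemma polarization_of_nonneg {x : E} (hx : 0 ≤ sideOf u c x) :
    polarization u c f x = max (f x) (f (hyperplaneReflection u c x)) := if_pos hx

lemma polarization_of_nonpos {x : E} (hx : sideOf u c x ≤ 0) :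
    polarization u c f x = min (f x) (f (hyperplaneReflection u c x)) := by
  rcases hx.lt_or_eq with h | h
  · exact if_neg h.not_ge
  · rw [polarization_of_nonneg h.ge, reflection_eq_self h, max_self, min_self]

lemma polarization_reflection_of_nonneg (hu : ‖u‖ = 1) {x : E} (hx : 0 ≤ sideOf u c x) :
    polarization u c f (hyperplaneReflection u c x) =
      min (f x) (f (hyperplaneReflection u c x)) := by
  rw [polarization_of_nonpos (by rw [sideOf_reflection hu]; linarith), reflection_involutive hu,
    min_comm]

lemma polarization_reflection_of_nonpos (hu : ‖u‖ = 1) {x : E} (hx : sideOf u c x ≤ 0) :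
    polarization u c f (hyperplaneReflection u c x) =
      max (f x) (f (hyperplaneReflection u c x)) := by
  rw [polarization_of_nonneg (by rw [sideOf_reflection hu]; linarith), reflection_involutive hu,
    max_comm]

lemma polarization_eq_or (x : E) : polarization u c f x = f x ∨
    polarization u c f x = f (hyperplaneReflection u c x) := by
  unfold polarization
  split_ifs
  · exact max_choice _ _
  · exact min_choice _ _

lemma polarization_add_reflection (hu : ‖u‖ = 1) (x : E) :
    polarization u c f x + polarization u c f (hyperplaneReflection u c x) =
      f x + f (hyperplaneReflection u c x) := by
  rcases le_total 0 (sideOf u c x) with h | h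
  · rw [polarization_of_nonneg h, polarization_reflection_of_nonneg hu h, max_add_min]
  · rw [polarization_of_nonpos h, polarization_reflection_of_nonpos hu h, min_add_max]

lemma lipschitzWith_polarization (hu : ‖u‖ = 1) {L : NNReal} (hf : LipschitzWith L f) :
    LipschitzWith L (polarization u c f) := by
  have hrefl : LipschitzWith L fun x => f (hyperplaneReflection u c x) := by
    simpa [Function.comp_def] using hf.comp (isometry_hyperplaneReflection (c := c) hu).lipschitz
  have key : ∀ x y, 0 ≤ sideOf u c x → sideOf u c y ≤ 0 →
      dist (polarization u c f x) (polarization u c f y) ≤ L * dist x y := by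
    intro x y hx hy
    have hd := dist_reflection_le_dist hu (mul_nonpos_of_nonneg_of_nonpos hx hy)
    have hL := mul_le_mul_of_nonneg_left hd L.coe_nonneg
    have h1 := hf.dist_le_mul x y
    have h2 := hrefl.dist_le_mul x y
    have h3 := (hf.dist_le_mul x (hyperplaneReflection u c y)).trans hL
    have h4 := hf.dist_le_mul (hyperplaneReflection u c x) y
    rw [dist_reflection_left hu] at h4
    have h4 := h4.trans hL
    rcases polarization_eq_or (f := f) (u := u) (c := c) x with h | h <;>
      rcases polarization_eq_or (f := f) (u := u) (c := c) y with h' | h' <;>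
      rw [h, h'] <;> assumption
  refine LipschitzWith.of_dist_le_mul fun x y => ?_
  rcases le_total 0 (sideOf u c x) with hx | hx <;> rcases le_total 0 (sideOf u c y) with hy | hy
  · rw [polarization_of_nonneg hx, polarization_of_nonneg hy]
    simpa using (hf.max hrefl).dist_le_mul x y
  · exact key x y hx hy
  · rw [dist_comm, dist_comm x]
    exact key y x hy hx
  · rw [polarization_of_nonpos hx, polarization_of_nonpos hy]
    simpa using (hf.min hrefl).dist_le_mul x y

lemma polarization_eq_zero (hu : ‖u‖ = 1) (hc : 0 ≤ c) {R : ℝ} (h0 : ∀ x, 0 ≤ f x)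
    (hR : ∀ x, R < ‖x‖ → f x = 0) (x : E) (hx : R < ‖x‖) : polarization u c f x = 0 := by
  rcases le_total 0 (sideOf u c x) with h | h
  · rw [polarization_of_nonneg h, hR x hx,
      hR _ (hx.trans_le (norm_le_norm_reflection hu hc h)), max_self]
  · rw [polarization_of_nonpos h, hR x hx, min_eq_left (h0 _)]

/-- The pointwise inequality behind the monotonicity of interaction energies under polarization. -/
lemma polarization_interaction_le (hu : ‖u‖ = 1) {k : ℝ → ℝ} (hk : Antitone k) (x y : E) :
    k (dist x y) * (f x * f y + f (hyperplaneReflection u c x) * f (hyperplaneReflection u c y)) +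
      k (dist x (hyperplaneReflection u c y)) *
        (f (hyperplaneReflection u c x) * f y + f x * f (hyperplaneReflection u c y)) ≤
    k (dist x y) * (polarization u c f x * polarization u c f y +
        polarization u c f (hyperplaneReflection u c x) *
          polarization u c f (hyperplaneReflection u c y)) +
      k (dist x (hyperplaneReflection u c y)) *
        (polarization u c f (hyperplaneReflection u c x) * polarization u c f y +
          polarization u c f x * polarization u c f (hyperplaneReflection u c y)) := by
  rcases le_total 0 (sideOf u c x) with hx | hx <;> rcases le_total 0 (sideOf u c y) with hy | hy
  · have hd := hk (dist_le_dist_reflection hu (mul_nonneg hx hy))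
    simp only [polarization_of_nonneg hx, polarization_of_nonneg hy,
      polarization_reflection_of_nonneg hu hx, polarization_reflection_of_nonneg hu hy]
    rcases le_total (f x) (f (hyperplaneReflection u c x)) with ha | ha <;>
      rcases le_total (f y) (f (hyperplaneReflection u c y)) with hb | hb <;>
      simp only [ha, hb, max_eq_left, max_eq_right, min_eq_left, min_eq_right] <;>
      nlinarith [mul_nonneg (sub_nonneg.2 hd) (mul_nonneg (sub_nonneg.2 ha) (sub_nonneg.2 hb))]
  · have hd := hk (dist_reflection_le_dist hu (mul_nonpos_of_nonneg_of_nonpos hx hy))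
    simp only [polarization_of_nonneg hx, polarization_of_nonpos hy,
      polarization_reflection_of_nonneg hu hx, polarization_reflection_of_nonpos hu hy]
    rcases le_total (f x) (f (hyperplaneReflection u c x)) with ha | ha <;>
      rcases le_total (f y) (f (hyperplaneReflection u c y)) with hb | hb <;>
      simp only [ha, hb, max_eq_left, max_eq_right, min_eq_left, min_eq_right] <;>
      nlinarith [mul_nonneg (sub_nonneg.2 hd) (mul_nonneg (sub_nonneg.2 ha) (sub_nonneg.2 hb))]
  · have hd := hk (dist_reflection_le_dist hu (mul_nonpos_of_nonpos_of_nonneg hx hy))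
    simp only [polarization_of_nonpos hx, polarization_of_nonneg hy,
      polarization_reflection_of_nonpos hu hx, polarization_reflection_of_nonneg hu hy]
    rcases le_total (f x) (f (hyperplaneReflection u c x)) with ha | ha <;>
      rcases le_total (f y) (f (hyperplaneReflection u c y)) with hb | hb <;>
      simp only [ha, hb, max_eq_left, max_eq_right, min_eq_left, min_eq_right] <;>
      nlinarith [mul_nonneg (sub_nonneg.2 hd) (mul_nonneg (sub_nonneg.2 ha) (sub_nonneg.2 hb))]
  · have hd := hk (dist_le_dist_reflection hu (mul_nonneg_of_nonpos_of_nonpos hx hy))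
    simp only [polarization_of_nonpos hx, polarization_of_nonpos hy,
      polarization_reflection_of_nonpos hu hx, polarization_reflection_of_nonpos hu hy]
    rcases le_total (f x) (f (hyperplaneReflection u c x)) with ha | ha <;>
      rcases le_total (f y) (f (hyperplaneReflection u c y)) with hb | hb <;>
      simp only [ha, hb, max_eq_left, max_eq_right, min_eq_left, min_eq_right] <;>
      nlinarith [mul_nonneg (sub_nonneg.2 hd) (mul_nonneg (sub_nonneg.2 ha) (sub_nonneg.2 hb))]

end Polarization

section Interaction

variable {E : Type*} [NormedAddCommGroup E] [InnerProductSpace ℝ E] [FiniteDimensional ℝ E]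
  [MeasurableSpace E] [BorelSpace E]

/-- The interaction of the densities `f` and `g` through the pair potential `k`. -/
def interaction (k : ℝ → ℝ) (f g : E → ℝ) : ℝ :=
  ∫ p : E × E, k (dist p.1 p.2) * (f p.1 * g p.2) ∂(volume.prod volume)

/-- The potential generated by the density `f` through the pair potential `k`. -/
def potential (k : ℝ → ℝ) (f : E → ℝ) (x : E) : ℝ := ∫ y, k (dist x y) * f y

/-- Functions that are nonincreasing with respect to the norm, hence in particular radial. -/
def RadiallyAntitone (f : E → ℝ) : Prop := ∀ x y, ‖x‖ ≤ ‖y‖ → f y ≤ f x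

variable {u : E} {c : ℝ}

lemma measurePreserving_hyperplaneReflection (hu : ‖u‖ = 1) :
    MeasurePreserving (hyperplaneReflection u c : E → E) := by
  have h : (hyperplaneReflection u c : E → E) =
      (fun z => z + (2 * c) • u) ∘ (ℝ ∙ u)ᗮ.reflection := funext (hyperplaneReflection_eq hu)
  rw [h]
  exact (measurePreserving_add_right volume _).comp (LinearIsometryEquiv.measurePreserving _)

lemma measurableEmbedding_hyperplaneReflection (hu : ‖u‖ = 1) :
    MeasurableEmbedding (hyperplaneReflection u c : E → E) :=
  (isometry_hyperplaneReflection hu).isClosedEmbedding.measurableEmbedding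

lemma integral_comp_reflection (hu : ‖u‖ = 1) (F : E → ℝ) :
    ∫ x, F (hyperplaneReflection u c x) = ∫ x, F x :=
  (measurePreserving_hyperplaneReflection hu).integral_comp
    (measurableEmbedding_hyperplaneReflection hu) F

lemma integrable_comp_reflection (hu : ‖u‖ = 1) {F : E → ℝ} (hF : Integrable F) :
    Integrable fun x => F (hyperplaneReflection u c x) :=
  (measurePreserving_hyperplaneReflection hu).integrable_comp_of_integrable hF

lemma two_mul_integral_eq (hu : ‖u‖ = 1) {F : E → ℝ} (hF : Integrable F) :
    2 * ∫ x, F x = ∫ x, (F x + F (hyperplaneReflection u c x)) := by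
  rw [integral_add hF (integrable_comp_reflection hu hF), integral_comp_reflection hu, two_mul]

lemma integral_polarization (hu : ‖u‖ = 1) {f : E → ℝ} (hf : Integrable f)
    (hp : Integrable (polarization u c f)) : ∫ x, polarization u c f x = ∫ x, f x := by
  have h := two_mul_integral_eq (c := c) hu hp
  simp only [polarization_add_reflection hu] at h
  linarith [two_mul_integral_eq (c := c) hu hf]

variable {k : ℝ → ℝ} {C : ℝ} {f g : E → ℝ}

lemma integrable_interaction (hk : Antitone k) (hC : ∀ r, |k r| ≤ C) (hf : Integrable f)
    (hg : Integrable g) :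
    Integrable (fun p : E × E => k (dist p.1 p.2) * (f p.1 * g p.2)) (volume.prod volume) :=
  (hf.mul_prod hg).bdd_mul (hk.measurable.comp measurable_dist).aestronglyMeasurable
    (ae_of_all _ fun _ => hC _)

lemma integrable_potential (hk : Antitone k) (hC : ∀ r, |k r| ≤ C) (hf : Integrable f) (x : E) :
    Integrable fun y => k (dist x y) * f y :=
  hf.bdd_mul (hk.measurable.comp (measurable_const.dist measurable_id)).aestronglyMeasurable
    (ae_of_all _ fun _ => hC _)

lemma interaction_comm (k : ℝ → ℝ) (f g : E → ℝ) : interaction k f g = interaction k g f := by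
  rw [interaction, ← integral_prod_swap]
  simp only [interaction, Prod.fst_swap, Prod.snd_swap, dist_comm, mul_comm]

lemma interaction_eq_integral_potential (hk : Antitone k) (hC : ∀ r, |k r| ≤ C)
    (hf : Integrable f) (hg : Integrable g) :
    interaction k f g = ∫ x, potential k g x * f x := by
  rw [interaction, integral_prod _ (integrable_interaction hk hC hf hg)]
  refine integral_congr_ae (ae_of_all _ fun x => ?_)
  simp only [potential, ← integral_mul_const]
  exact integral_congr_ae (ae_of_all _ fun y => by ring)

lemma integrable_potential_mul (hk : Antitone k) (hC : ∀ r, |k r| ≤ C)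
    (hf : Integrable f) (hg : Integrable g) : Integrable fun x => potential k g x * f x := by
  refine (integrable_interaction hk hC hf hg).integral_prod_left.congr (ae_of_all _ fun x => ?_)
  simp only [potential, ← integral_mul_const]
  exact integral_congr_ae (ae_of_all _ fun y => by ring)

/-- Symmetrizing the interaction over the reflections of both variables. -/
lemma four_mul_interaction (hu : ‖u‖ = 1) (hk : Antitone k) (hC : ∀ r, |k r| ≤ C)
    (hf : Integrable f) :
    let F := fun p : E × E =>
      k (dist p.1 p.2) * (f p.1 * f p.2 +
        f (hyperplaneReflection u c p.1) * f (hyperplaneReflection u c p.2)) +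
      k (dist p.1 (hyperplaneReflection u c p.2)) *
        (f (hyperplaneReflection u c p.1) * f p.2 + f p.1 * f (hyperplaneReflection u c p.2))
    Integrable F (volume.prod volume) ∧ 4 * interaction k f f = ∫ p, F p ∂(volume.prod volume) := by
  intro F
  set G := fun p : E × E => k (dist p.1 p.2) * (f p.1 * f p.2) with hG
  have hGi : Integrable G (volume.prod volume) := integrable_interaction hk hC hf hf
  have hσ := measurePreserving_hyperplaneReflection (E := E) (c := c) hu
  have hσe := measurableEmbedding_hyperplaneReflection (E := E) (c := c) hu
  have hid := MeasurePreserving.id (volume : Measure E)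
  have m1 := hσ.prod hσ
  have m2 := hσ.prod hid
  have m3 := hid.prod hσ
  have i1 := m1.integrable_comp_of_integrable hGi
  have i2 := m2.integrable_comp_of_integrable hGi
  have i3 := m3.integrable_comp_of_integrable hGi
  have e1 := m1.integral_comp (hσe.prodMap hσe) G
  have e2 := m2.integral_comp (hσe.prodMap MeasurableEmbedding.id) G
  have e3 := m3.integral_comp (MeasurableEmbedding.id.prodMap hσe) G
  have hF : F = G + G ∘ Prod.map (hyperplaneReflection u c) (hyperplaneReflection u c) +
      G ∘ Prod.map (hyperplaneReflection u c) id + G ∘ Prod.map id (hyperplaneReflection u c) := by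
    funext p
    simp only [F, hG, Pi.add_apply, Function.comp, Prod.map, id, dist_reflection_reflection hu,
      dist_reflection_left hu]
    ring
  rw [hF]
  refine ⟨((hGi.add i1).add i2).add i3, ?_⟩
  rw [integral_add' ((hGi.add i1).add i2) i3, integral_add' (hGi.add i1) i2, integral_add' hGi i1]
  simp only [Function.comp] at *
  rw [e1, e2, e3, interaction]
  ring

lemma interaction_le_interaction_polarization (hu : ‖u‖ = 1) (hk : Antitone k)
    (hC : ∀ r, |k r| ≤ C) (hf : Integrable f) (hp : Integrable (polarization u c f)) :
    interaction k f f ≤ interaction k (polarization u c f) (polarization u c f) := by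
  obtain ⟨i1, e1⟩ := four_mul_interaction (c := c) hu hk hC hf
  obtain ⟨i2, e2⟩ := four_mul_interaction (c := c) hu hk hC hp
  have := integral_mono i1 i2 fun p => polarization_interaction_le hu hk p.1 p.2
  linarith

lemma radiallyAntitone_potential (hf : RadiallyAntitone f) (hfi : Integrable f)
    (hk : Antitone k) (hC : ∀ r, |k r| ≤ C) : RadiallyAntitone (potential k f) := by
  intro x y hxy
  rcases eq_or_ne x y with rfl | hne
  · rfl
  obtain ⟨u, c, hu, hc, -, hx, rfl⟩ := exists_reflection_eq hne hxy
  set y := hyperplaneReflection u c x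
  have hx := hx.le
  have i1 := integrable_potential hk hC hfi x
  have i2 := integrable_potential hk hC hfi y
  have hi : Integrable fun z => (k (dist x z) - k (dist y z)) * f z := by
    simp only [sub_mul]
    exact i1.sub i2
  have e : ∫ z, (k (dist x z) - k (dist y z)) * f z =
      potential k f x - potential k f y := by
    simp only [sub_mul]
    exact integral_sub i1 i2
  have h0 : 0 ≤ ∫ z, ((k (dist x z) - k (dist y z)) * f z +
      (k (dist x (hyperplaneReflection u c z)) - k (dist y (hyperplaneReflection u c z))) *
        f (hyperplaneReflection u c z)) := by
    refine integral_nonneg fun z => ?_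
    simp only [y, dist_reflection_reflection hu, dist_reflection_left hu, Pi.zero_apply]
    rcases le_total 0 (sideOf u c z) with hz | hz
    · have h1 := hk (dist_le_dist_reflection hu (mul_nonneg hx hz))
      have h2 := hf _ _ (norm_le_norm_reflection hu hc hz)
      nlinarith [mul_nonneg (sub_nonneg.2 h1) (sub_nonneg.2 h2)]
    · have h1 := hk (dist_reflection_le_dist hu (mul_nonpos_of_nonneg_of_nonpos hx hz))
      have h2 := norm_le_norm_reflection (x := hyperplaneReflection u c z) hu hc
        (by rw [sideOf_reflection hu]; linarith)
      rw [reflection_involutive hu] at h2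
      nlinarith [mul_nonneg (sub_nonneg.2 h1) (sub_nonneg.2 (hf _ _ h2))]
  rw [← two_mul_integral_eq hu hi, e] at h0
  linarith

/-- The bathtub principle for radially nonincreasing weights. -/
lemma RadiallyAntitone.integral_mul_le [Nontrivial E] {V : E → ℝ} (hV : RadiallyAntitone V)
    {lam ε : ℝ} (hε : 0 ≤ ε) (h01 : ∀ x, 0 ≤ f x ∧ f x ≤ lam) (hf : Integrable f)
    (hmass : ∫ x, f x = ∫ x, (ball (0 : E) ε).indicator (fun _ => lam) x)
    (hVf : Integrable fun x => V x * f x)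
    (hVg : Integrable fun x => V x * (ball (0 : E) ε).indicator (fun _ => lam) x) :
    ∫ x, V x * f x ≤ ∫ x, V x * (ball (0 : E) ε).indicator (fun _ => lam) x := by
  obtain ⟨x₀, hx₀⟩ := exists_norm_eq E hε
  have hg : Integrable ((ball (0 : E) ε).indicator fun _ => lam) :=
    (integrable_indicator_iff measurableSet_ball).2
      (integrableOn_const measure_ball_lt_top.ne)
  have key : ∫ x, (V x * f x - V x * (ball (0 : E) ε).indicator (fun _ => lam) x) ≤
      ∫ x, V x₀ * (f x - (ball (0 : E) ε).indicator (fun _ => lam) x) := by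
    refine integral_mono (hVf.sub hVg) ((hf.sub hg).const_mul _) fun x => ?_
    by_cases hx : x ∈ ball (0 : E) ε
    · simp only [Set.indicator_of_mem hx]
      have := hV x x₀ (by rw [hx₀]; exact (mem_ball_zero_iff.1 hx).le)
      nlinarith [h01 x]
    · simp only [Set.indicator_of_notMem hx]
      have := hV x₀ x (by rw [hx₀]; simpa using hx)
      nlinarith [h01 x]
  rw [integral_sub hVf hVg, integral_const_mul, integral_sub hf hg, hmass, sub_self,
    mul_zero] at key
  linarith

lemma RadiallyAntitone.interaction_le [Nontrivial E] (hr : RadiallyAntitone f)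
    (hk : Antitone k) (hC : ∀ r, |k r| ≤ C)
    {lam ε : ℝ} (hε : 0 ≤ ε) (h01 : ∀ x, 0 ≤ f x ∧ f x ≤ lam) (hf : Integrable f)
    (hmass : ∫ x, f x = ∫ x, (ball (0 : E) ε).indicator (fun _ => lam) x) :
    interaction k f f ≤ interaction k ((ball (0 : E) ε).indicator fun _ => lam)
      ((ball (0 : E) ε).indicator fun _ => lam) := by
  have hlam : 0 ≤ lam := (h01 0).1.trans (h01 0).2
  set g := (ball (0 : E) ε).indicator fun _ => lam with hg_def
  have hg : Integrable g := (integrable_indicator_iff measurableSet_ball).2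
    (integrableOn_const measure_ball_lt_top.ne)
  have hgr : RadiallyAntitone g := fun x y hxy => by
    by_cases hy : y ∈ ball (0 : E) ε
    · have hx : x ∈ ball (0 : E) ε := by
        rw [mem_ball_zero_iff] at *
        linarith
      simp [g, Set.indicator_of_mem hx, Set.indicator_of_mem hy]
    · rw [hg_def, Set.indicator_of_notMem hy]
      exact Set.indicator_nonneg (fun _ _ => hlam) x
  calc interaction k f f = ∫ x, potential k f x * f x :=
        interaction_eq_integral_potential hk hC hf hf
    _ ≤ ∫ x, potential k f x * g x :=
        (radiallyAntitone_potential hr hf hk hC).integral_mul_le hε h01 hf hmass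
          (integrable_potential_mul hk hC hf hf) (integrable_potential_mul hk hC hg hf)
    _ = interaction k g f := (interaction_eq_integral_potential hk hC hg hf).symm
    _ = interaction k f g := interaction_comm k g f
    _ = ∫ x, potential k g x * f x := interaction_eq_integral_potential hk hC hf hg
    _ ≤ ∫ x, potential k g x * g x :=
        (radiallyAntitone_potential hgr hg hk hC).integral_mul_le hε h01 hf hmass
          (integrable_potential_mul hk hC hf hg) (integrable_potential_mul hk hC hg hg)
    _ = interaction k g g := (interaction_eq_integral_potential hk hC hg hg).symm

end Interaction

section Symmetrization

variable {E : Type*} [NormedAddCommGroup E]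

/-- The `L`-Lipschitz functions with values in `[0, lam]` that vanish outside the closed ball of
radius `R`. -/
def lipschitzDensities (E : Type*) [NormedAddCommGroup E] (L : NNReal) (lam R : ℝ) :
    Set C(E, ℝ) :=
  {f | LipschitzWith L f ∧ (∀ x, 0 ≤ f x ∧ f x ≤ lam) ∧ ∀ x, R < ‖x‖ → f x = 0}

variable {L : NNReal} {lam R : ℝ}

lemma isCompact_lipschitzDensities : IsCompact (lipschitzDensities E L lam R) := by
  refine ArzelaAscoli.isCompact_of_equicontinuous _ ?_ ?_
  · have himage : ContinuousMap.toFun '' lipschitzDensities E L lam R =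
        {f : E → ℝ | LipschitzWith L f} ∩ (Set.univ.pi fun _ => Set.Icc 0 lam) ∩
          {f : E → ℝ | ∀ x, R < ‖x‖ → f x = 0} := by
      ext f
      constructor
      · rintro ⟨g, ⟨h1, h2, h3⟩, rfl⟩
        exact ⟨⟨h1, fun x _ => h2 x⟩, h3⟩
      · rintro ⟨⟨h1, h2⟩, h3⟩
        exact ⟨⟨f, h1.continuous⟩, ⟨h1, fun x => h2 x trivial, h3⟩, rfl⟩
    rw [himage]
    have hc : IsClosed {f : E → ℝ | ∀ x, R < ‖x‖ → f x = 0} := by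
      simp only [Set.ofPred_forall]
      exact isClosed_iInter fun x => isClosed_iInter fun _ =>
        isClosed_eq (continuous_apply x) continuous_const
    have hl : IsClosed {f : E → ℝ | LipschitzWith L f} := by
      simp only [lipschitzWith_iff_dist_le_mul, Set.ofPred_forall]
      exact isClosed_iInter fun x => isClosed_iInter fun y =>
        isClosed_le ((continuous_apply x).dist (continuous_apply y)) continuous_const
    exact ((isCompact_univ_pi fun _ => isCompact_Icc).inter_left hl).inter_right hc
  · exact (LipschitzWith.uniformEquicontinuous _ L fun f => f.2.1).equicontinuous

lemma abs_le_indicator_closedBall {ω : E → ℝ} (h01 : ∀ x, 0 ≤ ω x ∧ ω x ≤ lam)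
    (hR : ∀ x, R < ‖x‖ → ω x = 0) (x : E) :
    |ω x| ≤ (closedBall (0 : E) R).indicator (fun _ => lam) x := by
  by_cases hx : x ∈ closedBall (0 : E) R
  · rw [Set.indicator_of_mem hx, abs_of_nonneg (h01 x).1]
    exact (h01 x).2
  · rw [Set.indicator_of_notMem hx, hR x (by simpa using hx), abs_zero]

lemma abs_le_indicator_of_mem {f : C(E, ℝ)} (hf : f ∈ lipschitzDensities E L lam R) (x : E) :
    |f x| ≤ (closedBall (0 : E) R).indicator (fun _ => lam) x :=
  abs_le_indicator_closedBall hf.2.1 hf.2.2 x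

variable [InnerProductSpace ℝ E] [FiniteDimensional ℝ E] [MeasurableSpace E] [BorelSpace E]

lemma integrable_indicator_closedBall :
    Integrable ((closedBall (0 : E) R).indicator fun _ => lam) := by
  have := FiniteDimensional.proper_real E
  exact (integrable_indicator_iff measurableSet_closedBall).2
    (integrableOn_const measure_closedBall_lt_top.ne)

lemma integrable_of_mem_lipschitzDensities {f : C(E, ℝ)} (hf : f ∈ lipschitzDensities E L lam R) :
    Integrable f :=
  integrable_indicator_closedBall.mono' f.continuous.aestronglyMeasurable
    (ae_of_all _ (abs_le_indicator_of_mem hf))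

lemma continuousOn_integral_mul {w : E → ℝ} (hw : Continuous w) :
    ContinuousOn (fun f : C(E, ℝ) => ∫ x, w x * f x) (lipschitzDensities E L lam R) := by
  have := FiniteDimensional.proper_real E
  refine continuousOn_of_dominated
    (bound := (closedBall (0 : E) R).indicator fun x => |w x| * lam)
    (fun f _ => (hw.mul f.continuous).aestronglyMeasurable) (fun f hf => ae_of_all _ fun x => ?_)
    ?_ (ae_of_all _ fun x =>
      (continuous_const.mul (continuous_eval_const x)).continuousOn)
  · have := abs_le_indicator_of_mem hf x
    rw [Real.norm_eq_abs, abs_mul]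
    by_cases hx : x ∈ closedBall (0 : E) R
    · rw [Set.indicator_of_mem hx] at *
      gcongr
    · rw [Set.indicator_of_notMem hx] at *
      nlinarith [abs_nonneg (w x)]
  · exact (integrable_indicator_iff measurableSet_closedBall).2
      ((hw.abs.mul continuous_const).continuousOn.integrableOn_compact
        (isCompact_closedBall _ _))

lemma continuousOn_interaction {k : ℝ → ℝ} {C : ℝ} (hk : Antitone k) (hC : ∀ r, |k r| ≤ C) :
    ContinuousOn (fun f : C(E, ℝ) => interaction k f f) (lipschitzDensities E L lam R) := by
  have := FiniteDimensional.proper_real E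
  have hI := integrable_indicator_closedBall (E := E) (R := R) (lam := lam)
  refine continuousOn_of_dominated
    (bound := fun p : E × E => C * ((closedBall (0 : E) R).indicator (fun _ => lam) p.1 *
      (closedBall (0 : E) R).indicator (fun _ => lam) p.2))
    (fun f hf => (integrable_interaction hk hC (integrable_of_mem_lipschitzDensities hf)
      (integrable_of_mem_lipschitzDensities hf)).aestronglyMeasurable)
    (fun f hf => ae_of_all _ fun p => ?_) ((hI.mul_prod hI).const_mul C)
    (ae_of_all _ fun p => by fun_prop)
  rw [Real.norm_eq_abs, abs_mul, abs_mul]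
  have h1 := abs_le_indicator_of_mem hf p.1
  have h2 := abs_le_indicator_of_mem hf p.2
  have h3 := (abs_nonneg _).trans h1
  have h4 := (abs_nonneg _).trans (hC 0)
  gcongr
  exact hC _

/-- Some radially nonincreasing Lipschitz density with the same mass has at least as much
interaction energy: minimize the second moment. -/
lemma exists_radiallyAntitone {k : ℝ → ℝ} {C : ℝ} (hk : Antitone k) (hC : ∀ r, |k r| ≤ C)
    {f₀ : C(E, ℝ)} (hf₀ : f₀ ∈ lipschitzDensities E L lam R) :
    ∃ f ∈ lipschitzDensities E L lam R, RadiallyAntitone f ∧ ∫ x, f x = ∫ x, f₀ x ∧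
      interaction k f₀ f₀ ≤ interaction k f f := by
  have := FiniteDimensional.proper_real E
  set T := lipschitzDensities E L lam R
  have hT : IsCompact T := isCompact_lipschitzDensities
  have hmassc : ContinuousOn (fun f : C(E, ℝ) => ∫ x, f x) T := by
    simpa using continuousOn_integral_mul (E := E) (L := L) (lam := lam) (R := R)
      (w := fun _ => 1) continuous_const
  set S := T ∩ (fun f : C(E, ℝ) => (∫ x, f x, interaction k f f)) ⁻¹'
    ({∫ x, f₀ x} ×ˢ Set.Ici (interaction k f₀ f₀)) with hS_def
  have hS : IsCompact S := hT.of_isClosed_subset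
    ((hmassc.prodMk (continuousOn_interaction hk hC)).preimage_isClosed_of_isClosed hT.isClosed
      (isClosed_singleton.prod isClosed_Ici)) Set.inter_subset_left
  obtain ⟨f, ⟨hfT, hfm, hfI⟩, hmin⟩ := hS.exists_isMinOn ⟨f₀, hf₀, by simp⟩
    ((continuousOn_integral_mul (w := fun x : E => ‖x‖ ^ 2) (by fun_prop)).mono
      Set.inter_subset_left)
  refine ⟨f, hfT, ?_, hfm, hfI⟩
  have hlt : ∀ x y, ‖x‖ < ‖y‖ → f y ≤ f x := by
    intro x y hxy
    obtain ⟨u, c, hu, -, hc, hx, rfl⟩ :=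
      exists_reflection_eq (by rintro rfl; exact lt_irrefl _ hxy) hxy.le
    have hc := hc hxy
    obtain ⟨hL, h01, hR⟩ := hfT
    have hpL := lipschitzWith_polarization (c := c) hu hL
    let g : C(E, ℝ) := ⟨polarization u c f, hpL.continuous⟩
    have hgT : g ∈ T := ⟨hpL, fun z => by
      rcases polarization_eq_or (f := f) (u := u) (c := c) z with h | h <;>
        simp only [g, ContinuousMap.coe_mk, h] <;> exact h01 _,
      polarization_eq_zero hu hc.le (fun z => (h01 z).1) hR⟩
    have hfi := integrable_of_mem_lipschitzDensities (f := f) ⟨hL, h01, hR⟩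
    have hgi : Integrable (polarization u c f) := integrable_of_mem_lipschitzDensities hgT
    have hgS : g ∈ S := ⟨hgT, (integral_polarization hu hfi hgi).trans hfm,
      le_trans hfI (interaction_le_interaction_polarization hu hk hC hfi hgi)⟩
    have hle : ∫ z, ‖z‖ ^ 2 * f z ≤ ∫ z, ‖z‖ ^ 2 * polarization u c f z := hmin hgS
    have hmom : ∀ h ∈ T, Integrable fun z => ‖z‖ ^ 2 * h z := fun h hh =>
      ((continuous_norm.pow 2).mul h.continuous).integrable_of_hasCompactSupport
        (HasCompactSupport.intro (isCompact_closedBall (0 : E) R) fun z hz => by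
          change ‖z‖ ^ 2 * h z = 0
          rw [hh.2.2 z (by simpa using hz), mul_zero])
    have i1 := hmom f ⟨hL, h01, hR⟩
    have i2 : Integrable fun z => ‖z‖ ^ 2 * polarization u c f z := hmom g hgT
    set D : E → ℝ := fun z => (‖z‖ ^ 2 * f z - ‖z‖ ^ 2 * polarization u c f z) +
      (‖hyperplaneReflection u c z‖ ^ 2 * f (hyperplaneReflection u c z) -
        ‖hyperplaneReflection u c z‖ ^ 2 * polarization u c f (hyperplaneReflection u c z))
      with hD
    have hD0 : ∀ z, 0 ≤ D z := by
      intro z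
      have hadd := polarization_add_reflection (c := c) (f := f) hu z
      have hn := norm_reflection_sq (c := c) hu z
      have e : D z = 4 * c * (sideOf u c z * (polarization u c f z - f z)) := by
        simp only [hD, hn]
        linear_combination (‖z‖ ^ 2 + 4 * c * sideOf u c z) * (-hadd)
      rw [e]
      refine mul_nonneg (by positivity) ?_
      rcases le_total 0 (sideOf u c z) with hz | hz
      · rw [polarization_of_nonneg hz]
        exact mul_nonneg hz (sub_nonneg.2 (le_max_left _ _))
      · rw [polarization_of_nonpos hz]
        exact mul_nonneg_of_nonpos_of_nonpos hz (sub_nonpos.2 (min_le_left _ _))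
    have hDi : Integrable D :=
      (i1.sub i2).add (integrable_comp_reflection hu (i1.sub i2))
    have hDint : ∫ z, D z = 0 := by
      refine le_antisymm ?_ (integral_nonneg hD0)
      have h2 := two_mul_integral_eq (c := c) hu (i1.sub i2)
      simp only [Pi.sub_apply] at h2
      rw [hD, ← h2, integral_sub i1 i2]
      linarith
    have hDc : Continuous D := by
      have h1 := f.continuous
      have h2 := hpL.continuous
      have h3 := (isometry_hyperplaneReflection (c := c) hu).continuous
      fun_prop
    have hDzero : D = 0 := ((hDc.ae_eq_iff_eq volume continuous_zero).1
      ((integral_eq_zero_iff_of_nonneg hD0 hDi).1 hDint))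
    have hDx := congrFun hDzero x
    have hn := norm_reflection_sq (c := c) hu x
    simp only [hD, Pi.zero_apply, polarization_of_nonneg hx.le,
      polarization_reflection_of_nonneg hu hx.le, hn] at hDx
    by_contra! hcon
    rw [max_eq_right hcon.le, min_eq_left hcon.le] at hDx
    nlinarith [mul_pos (mul_pos hc hx) (sub_pos.2 hcon)]
  intro x y hxy
  rcases hxy.lt_or_eq with h | h
  · exact hlt x y h
  rcases eq_or_ne x 0 with rfl | hx
  · rw [norm_zero, eq_comm, norm_eq_zero] at h
    rw [h]
  have ht : Tendsto (fun t : ℝ => f (t • x)) (𝓝[<] 1) (𝓝 (f ((1 : ℝ) • x))) :=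
    (Continuous.tendsto (by fun_prop) 1).mono_left nhdsWithin_le_nhds
  rw [one_smul] at ht
  refine ge_of_tendsto ht ?_
  filter_upwards [Ioo_mem_nhdsLT (zero_lt_one (α := ℝ))] with t ht
  refine hlt _ _ ?_
  rw [norm_smul, Real.norm_of_nonneg ht.1.le, ← h]
  nlinarith [ht.2, norm_pos_iff.2 hx]

end Symmetrization

section Density

variable {E : Type*} [NormedAddCommGroup E] [InnerProductSpace ℝ E] [FiniteDimensional ℝ E]
  [MeasurableSpace E] [BorelSpace E] {lam R : ℝ} {ω : E → ℝ}

lemma integrable_of_bounded_support (hω : Measurable ω) (h01 : ∀ x, 0 ≤ ω x ∧ ω x ≤ lam)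
    (hR : ∀ x, R < ‖x‖ → ω x = 0) : Integrable ω :=
  integrable_indicator_closedBall.mono' hω.aestronglyMeasurable
    (ae_of_all _ (abs_le_indicator_closedBall h01 hR))

lemma exists_mollification_mem (hω : Measurable ω) (h01 : ∀ x, 0 ≤ ω x ∧ ω x ≤ lam)
    (hR : ∀ x, R < ‖x‖ → ω x = 0) (φ : ContDiffBump (0 : E)) (hφ : φ.rOut ≤ 1) :
    ∃ (L : NNReal), ∃ f ∈ lipschitzDensities E L lam (R + 1), ∫ x, f x = ∫ x, ω x ∧
      ⇑f = convolution (φ.normed volume) ω (ContinuousLinearMap.lsmul ℝ ℝ) volume := by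
  have hωi := integrable_of_bounded_support hω h01 hR
  set f := convolution (φ.normed volume) ω (ContinuousLinearMap.lsmul ℝ ℝ) volume with hf
  have hfR : ∀ x, R + 1 < ‖x‖ → f x = 0 := by
    intro x hx
    by_contra hne
    obtain ⟨y, hy, z, hz, rfl⟩ :=
      support_convolution_subset (ContinuousLinearMap.lsmul ℝ ℝ) (Function.mem_support.2 hne)
    rw [φ.support_normed_eq, mem_ball_zero_iff] at hy
    have hz' : ‖z‖ ≤ R := by
      by_contra! h
      exact hz (hR z h)
    have := norm_add_le y z
    dsimp only at hx
    linarith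
  have hcs : HasCompactSupport f := by
    have := FiniteDimensional.proper_real E
    exact HasCompactSupport.intro (isCompact_closedBall (0 : E) (R + 1)) fun x hx =>
      hfR x (by simpa using hx)
  have hcd : ContDiff ℝ ((1 : ℕ∞) : WithTop ℕ∞) f :=
    φ.hasCompactSupport_normed.contDiff_convolution_left _ φ.contDiff_normed hωi.locallyIntegrable
  obtain ⟨L, hL⟩ := hcd.lipschitzWith_of_hasCompactSupport hcs (by simp)
  have hint : ∀ x, Integrable fun t => φ.normed volume t * ω (x - t) := fun x => by
    refine (φ.integrable_normed.mul_const lam).mono' ?_ (ae_of_all _ fun t => ?_)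
    · exact (φ.continuous_normed.measurable.mul
        (hω.comp (measurable_const.sub measurable_id))).aestronglyMeasurable
    · rw [Real.norm_of_nonneg (mul_nonneg (φ.nonneg_normed _) (h01 _).1)]
      exact mul_le_mul_of_nonneg_left (h01 _).2 (φ.nonneg_normed _)
  refine ⟨L, ⟨f, hL.continuous⟩, ⟨hL, fun x => ⟨?_, ?_⟩, hfR⟩, ?_, rfl⟩
  · exact integral_nonneg fun t => mul_nonneg (φ.nonneg_normed _) (h01 _).1
  · calc f x = ∫ t, φ.normed volume t * ω (x - t) := rfl
      _ ≤ ∫ t, φ.normed volume t * lam :=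
        integral_mono (hint x) (φ.integrable_normed.mul_const lam) fun t =>
          mul_le_mul_of_nonneg_left (h01 _).2 (φ.nonneg_normed _)
      _ = lam := by rw [integral_mul_const, φ.integral_normed, one_mul]
  · change ∫ x, f x = _
    rw [hf, integral_convolution _ φ.integrable_normed hωi, φ.integral_normed]
    simp

/-- Riesz's rearrangement inequality for a bounded nonincreasing pair potential, among densities
with a given bound and mass. -/
theorem interaction_le_interaction_ball [Nontrivial E] {k : ℝ → ℝ} {C : ℝ} (hk : Antitone k)
    (hC : ∀ r, |k r| ≤ C) (hω : Measurable ω) (h01 : ∀ x, 0 ≤ ω x ∧ ω x ≤ lam)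
    (hR : ∀ x, R < ‖x‖ → ω x = 0) {ε : ℝ} (hε : 0 ≤ ε)
    (hmass : ∫ x, ω x = ∫ x, (ball (0 : E) ε).indicator (fun _ => lam) x) :
    interaction k ω ω ≤ interaction k ((ball (0 : E) ε).indicator fun _ => lam)
      ((ball (0 : E) ε).indicator fun _ => lam) := by
  have hωi := integrable_of_bounded_support hω h01 hR
  let φ : ℕ → ContDiffBump (0 : E) := fun n =>
    ⟨1 / (2 * (n + 1)), 1 / (n + 1), by positivity, by
      apply one_div_lt_one_div_of_lt <;> linarith [n.cast_nonneg (α := ℝ)]⟩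
  have hφ1 : ∀ n, (φ n).rOut ≤ 1 := fun n => by
    change 1 / ((n : ℝ) + 1) ≤ 1
    rw [div_le_one (by positivity)]
    linarith [n.cast_nonneg (α := ℝ)]
  choose L f hfT hfm hf using fun n => exists_mollification_mem hω h01 hR (φ n) (hφ1 n)
  have hlim : ∀ᵐ x, Tendsto (fun n => f n x) atTop (𝓝 (ω x)) := by
    simp only [hf]
    refine ContDiffBump.ae_convolution_tendsto_right_of_locallyIntegrable (K := 2)
      tendsto_one_div_add_atTop_nhds_zero_nat (Eventually.of_forall fun n => ?_)
      hωi.locallyIntegrable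
    change 1 / ((n : ℝ) + 1) ≤ 2 * (1 / (2 * (n + 1)))
    exact le_of_eq (by field_simp)
  have hI := integrable_indicator_closedBall (E := E) (R := R + 1) (lam := lam)
  have hle : ∀ n, interaction k (f n) (f n) ≤ interaction k
      ((ball (0 : E) ε).indicator fun _ => lam) ((ball (0 : E) ε).indicator fun _ => lam) := by
    intro n
    obtain ⟨g, hgT, hgr, hgm, hgI⟩ := exists_radiallyAntitone hk hC (hfT n)
    exact hgI.trans (hgr.interaction_le hk hC hε hgT.2.1
      (integrable_of_mem_lipschitzDensities hgT) ((hgm.trans (hfm n)).trans hmass))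
  refine le_of_tendsto (tendsto_integral_of_dominated_convergence
    (fun p : E × E => C * ((closedBall (0 : E) (R + 1)).indicator (fun _ => lam) p.1 *
      (closedBall (0 : E) (R + 1)).indicator (fun _ => lam) p.2))
    (fun n => (integrable_interaction hk hC (integrable_of_mem_lipschitzDensities (hfT n))
      (integrable_of_mem_lipschitzDensities (hfT n))).aestronglyMeasurable)
    ((hI.mul_prod hI).const_mul C) (fun n => ae_of_all _ fun p => ?_) ?_)
    (Eventually.of_forall hle)
  · rw [Real.norm_eq_abs, abs_mul, abs_mul]
    have h1 := abs_le_indicator_of_mem (hfT n) p.1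
    have h2 := abs_le_indicator_of_mem (hfT n) p.2
    have h3 := (abs_nonneg _).trans h1
    have h4 := (abs_nonneg _).trans (hC 0)
    gcongr
    exact hC _
  · filter_upwards [Measure.quasiMeasurePreserving_fst.ae hlim,
      Measure.quasiMeasurePreserving_snd.ae hlim] with p h1 h2
    exact (h1.mul h2).const_mul _

end Density

section LogKernel

/-- The logarithmic pair potential `r ↦ log (1 / r)` with its argument clamped to `[δ, M]`. -/
def clampedLog (δ M r : ℝ) : ℝ := -Real.log (max δ (min r M))

variable {δ M R lam : ℝ}

lemma antitone_clampedLog (hδ : 0 < δ) : Antitone (clampedLog δ M) := fun r s hrs =>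
  neg_le_neg (Real.log_le_log (lt_max_of_lt_left hδ) (by gcongr))

lemma abs_clampedLog_le (hδ : 0 < δ) (hM : δ ≤ M) (r : ℝ) :
    |clampedLog δ M r| ≤ max |Real.log δ| |Real.log M| := by
  rw [clampedLog, abs_neg]
  exact abs_le_max_abs_abs (Real.log_le_log hδ (le_max_left _ _))
    (Real.log_le_log (lt_max_of_lt_left hδ) (max_le hM (min_le_right _ _)))

lemma abs_clampedLog_le_abs_log (hδ : 0 < δ) (hδ1 : δ ≤ 1) {r : ℝ} (hr : 0 < r) (hrM : r ≤ M) :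
    |clampedLog δ M r| ≤ |Real.log r| := by
  rw [clampedLog, abs_neg, min_eq_left hrM]
  rcases le_total δ r with h | h
  · rw [max_eq_right h]
  · rw [max_eq_left h, abs_of_nonpos (Real.log_nonpos hδ.le hδ1),
      abs_of_nonpos (Real.log_nonpos hr.le (h.trans hδ1))]
    exact neg_le_neg (Real.log_le_log hr h)

lemma tendsto_clampedLog {r : ℝ} (hr : 0 < r) (hrM : r ≤ M) :
    Tendsto (fun n : ℕ => clampedLog (1 / ((n : ℝ) + 1)) M r) atTop (𝓝 (Real.log (1 / r))) := by
  refine tendsto_const_nhds.congr' ?_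
  filter_upwards [tendsto_one_div_add_atTop_nhds_zero_nat.eventually_le_const hr] with n hn
  rw [clampedLog, min_eq_left hrM, max_eq_right hn, one_div, Real.log_inv]

lemma integrable_log_norm_indicator (M : ℝ) :
    Integrable fun z : E2 => (Set.Iic M).indicator (fun r => |Real.log r|) ‖z‖ := by
  rw [integrable_fun_norm_addHaar volume (f := (Set.Iic M).indicator fun r => |Real.log r|)]
  have h : IntegrableOn (fun y : ℝ => |y * Real.log y|) (Set.Ioi 0 ∩ Set.Iic M) :=
    (Real.continuous_mul_log.abs.continuousOn.integrableOn_compact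
      (isCompact_Icc (a := 0) (b := M))).mono_set fun y hy => ⟨le_of_lt hy.1, hy.2⟩
  have h' : IntegrableOn ((Set.Iic M).indicator fun y : ℝ => |y * Real.log y|) (Set.Ioi 0) := by
    rw [IntegrableOn, integrable_indicator_iff measurableSet_Iic, IntegrableOn,
      Measure.restrict_restrict measurableSet_Iic, Set.inter_comm]
    exact h
  refine h'.congr_fun (fun y hy => ?_) measurableSet_Ioi
  have hy : 0 < y := hy
  by_cases hyM : y ∈ Set.Iic M
  · simp [hyM, abs_mul, abs_of_pos hy]
  · simp [hyM]

lemma ae_prod_fst_ne_snd : ∀ᵐ p : E2 × E2 ∂(volume.prod volume), p.1 ≠ p.2 := by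
  have hm : MeasurableSet {p : E2 × E2 | ¬p.1 ≠ p.2} := by
    simp only [not_not]
    exact measurableSet_eq_fun measurable_fst measurable_snd
  rw [ae_iff, Measure.measure_prod_null hm]
  refine ae_of_all _ fun x => ?_
  simp [Set.preimage]

variable {ω : E2 → ℝ}

/-- The integrable function dominating all logarithmic interactions of densities bounded by `lam`
and supported in the ball of radius `R`. -/
lemma integrable_log_bound (M R lam : ℝ) :
    Integrable (fun p : E2 × E2 => lam * ((closedBall (0 : E2) R).indicator (fun _ => lam) p.2 *
      (Set.Iic M).indicator (fun r => |Real.log r|) ‖p.1 - p.2‖)) (volume.prod volume) :=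
  ((integrable_indicator_closedBall (E := E2)).convolution_integrand
    (ContinuousLinearMap.mul ℝ ℝ) (integrable_log_norm_indicator M)).const_mul lam

lemma abs_mul_density_le (h01 : ∀ x, 0 ≤ ω x ∧ ω x ≤ lam) (hR : ∀ x, R < ‖x‖ → ω x = 0)
    (hM : 2 * R ≤ M) {p : E2 × E2} {a : ℝ}
    (ha : dist p.1 p.2 ≤ M → |a| ≤ |Real.log (dist p.1 p.2)|) :
    ‖a * (ω p.1 * ω p.2)‖ ≤ lam * ((closedBall (0 : E2) R).indicator (fun _ => lam) p.2 *
      (Set.Iic M).indicator (fun r => |Real.log r|) ‖p.1 - p.2‖) := by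
  have hlam : 0 ≤ lam := (h01 0).1.trans (h01 0).2
  rw [← dist_eq_norm]
  have h2 := abs_le_indicator_closedBall h01 hR p.2
  have hb : 0 ≤ (Set.Iic M).indicator (fun r => |Real.log r|) (dist p.1 p.2) :=
    Set.indicator_nonneg (fun _ _ => abs_nonneg _) _
  by_cases h : ω p.1 * ω p.2 = 0
  · rw [h, mul_zero, norm_zero]
    exact mul_nonneg hlam (mul_nonneg ((abs_nonneg _).trans h2) hb)
  have hp1 : ‖p.1‖ ≤ R := by
    by_contra! hlt
    exact h (by rw [hR _ hlt, zero_mul])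
  have hp2 : ‖p.2‖ ≤ R := by
    by_contra! hlt
    exact h (by rw [hR _ hlt, mul_zero])
  have hd : dist p.1 p.2 ≤ M := by
    rw [dist_eq_norm]
    linarith [norm_sub_le p.1 p.2]
  rw [Set.indicator_of_mem (show dist p.1 p.2 ∈ Set.Iic M from hd), Real.norm_eq_abs, abs_mul,
    abs_mul]
  calc |a| * (|ω p.1| * |ω p.2|) ≤ |Real.log (dist p.1 p.2)| *
        (lam * (closedBall (0 : E2) R).indicator (fun _ => lam) p.2) := by
        have h1 : |ω p.1| ≤ lam := by
          rw [abs_of_nonneg (h01 _).1]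
          exact (h01 _).2
        exact mul_le_mul (ha hd) (mul_le_mul h1 h2 (abs_nonneg _) hlam) (by positivity)
          (abs_nonneg _)
    _ = _ := by ring

lemma integrable_log_interaction (hω : Measurable ω) (h01 : ∀ x, 0 ≤ ω x ∧ ω x ≤ lam)
    (hR : ∀ x, R < ‖x‖ → ω x = 0) :
    Integrable (fun p : E2 × E2 => Real.log (1 / dist p.1 p.2) * (ω p.1 * ω p.2))
      (volume.prod volume) := by
  refine (integrable_log_bound (2 * R) R lam).mono' ?_ (ae_of_all _ fun p => ?_)
  · refine Measurable.aestronglyMeasurable ?_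
    fun_prop
  · exact abs_mul_density_le h01 hR le_rfl fun _ => by rw [one_div, Real.log_inv, abs_neg]

lemma tendsto_interaction_clampedLog (hω : Measurable ω) (h01 : ∀ x, 0 ≤ ω x ∧ ω x ≤ lam)
    (hR : ∀ x, R < ‖x‖ → ω x = 0) (hM : 2 * R ≤ M) (hM1 : 1 ≤ M) :
    Tendsto (fun n : ℕ => interaction (clampedLog (1 / ((n : ℝ) + 1)) M) ω ω) atTop
      (𝓝 (interaction (fun r => Real.log (1 / r)) ω ω)) := by
  have hδ : ∀ n : ℕ, 0 < 1 / ((n : ℝ) + 1) := fun n => by positivity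
  have hδ1 : ∀ n : ℕ, 1 / ((n : ℝ) + 1) ≤ 1 := fun n => by
    rw [div_le_one (by positivity)]
    linarith [n.cast_nonneg (α := ℝ)]
  have hωi := integrable_of_bounded_support hω h01 hR
  refine tendsto_integral_of_dominated_convergence _
    (fun n => (integrable_interaction (antitone_clampedLog (hδ n))
      (abs_clampedLog_le (hδ n) ((hδ1 n).trans hM1)) hωi hωi).aestronglyMeasurable)
    (integrable_log_bound M R lam) (fun n => ?_) ?_
  · filter_upwards [ae_prod_fst_ne_snd] with p hp
    exact abs_mul_density_le h01 hR hM fun hd =>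
      abs_clampedLog_le_abs_log (hδ n) (hδ1 n) (dist_pos.2 hp) hd
  · filter_upwards [ae_prod_fst_ne_snd] with p hp
    by_cases h : ω p.1 * ω p.2 = 0
    · simp [h]
    refine (tendsto_clampedLog (dist_pos.2 hp) ?_).mul_const _
    have hp1 : ‖p.1‖ ≤ R := by
      by_contra! hlt
      exact h (by rw [hR _ hlt, zero_mul])
    have hp2 : ‖p.2‖ ≤ R := by
      by_contra! hlt
      exact h (by rw [hR _ hlt, mul_zero])
    rw [dist_eq_norm]
    linarith [norm_sub_le p.1 p.2]

/-- Among densities with a given bound and mass, the uniform patch on a disc maximizes the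
logarithmic interaction energy. -/
theorem log_interaction_le_interaction_ball (hω : Measurable ω)
    (h01 : ∀ x, 0 ≤ ω x ∧ ω x ≤ lam) (hR : ∀ x, R < ‖x‖ → ω x = 0) {ε : ℝ} (hε : 0 ≤ ε)
    (hmass : ∫ x, ω x = ∫ x, (ball (0 : E2) ε).indicator (fun _ => lam) x) :
    interaction (fun r => Real.log (1 / r)) ω ω ≤ interaction (fun r => Real.log (1 / r))
      ((ball (0 : E2) ε).indicator fun _ => lam) ((ball (0 : E2) ε).indicator fun _ => lam) := by
  have hlam : 0 ≤ lam := (h01 0).1.trans (h01 0).2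
  have hM1 : (1 : ℝ) ≤ max 1 (2 * max R ε) := le_max_left _ _
  have hMR : 2 * R ≤ max 1 (2 * max R ε) := le_max_of_le_right (by gcongr; exact le_max_left _ _)
  have hMε : 2 * ε ≤ max 1 (2 * max R ε) := le_max_of_le_right (by gcongr; exact le_max_right _ _)
  have h01g : ∀ x : E2, 0 ≤ (ball (0 : E2) ε).indicator (fun _ => lam) x ∧
      (ball (0 : E2) ε).indicator (fun _ => lam) x ≤ lam := fun x =>
    ⟨Set.indicator_nonneg (fun _ _ => hlam) x, Set.indicator_le_self' (fun _ _ => hlam) x⟩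
  refine le_of_tendsto_of_tendsto' (tendsto_interaction_clampedLog hω h01 hR hMR hM1)
    (tendsto_interaction_clampedLog (measurable_const.indicator measurableSet_ball) h01g
      (R := ε) (fun x hx => Set.indicator_of_notMem (by simpa using hx.le) _) hMε hM1) fun n => ?_
  have hδ : 0 < 1 / ((n : ℝ) + 1) := by positivity
  have hδ1 : 1 / ((n : ℝ) + 1) ≤ 1 := by
    rw [div_le_one (by positivity)]
    linarith [n.cast_nonneg (α := ℝ)]
  exact interaction_le_interaction_ball (antitone_clampedLog hδ)
    (abs_clampedLog_le hδ (hδ1.trans hM1)) hω h01 hR hε hmass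

lemma interaction_log_indicator_ball {ε : ℝ} (hlam : 0 ≤ lam) :
    interaction (fun r => Real.log (1 / r)) ((ball (0 : E2) ε).indicator fun _ => lam)
      ((ball (0 : E2) ε).indicator fun _ => lam) =
    lam ^ 2 * ∫ x in ball (0 : E2) ε, ∫ y in ball (0 : E2) ε, Real.log (1 / dist x y) := by
  have hi := integrable_log_interaction (R := ε) (lam := lam)
    (measurable_const.indicator (measurableSet_ball (x := (0 : E2)) (ε := ε)))
    (fun x => ⟨Set.indicator_nonneg (fun _ _ => hlam) x,
      Set.indicator_le_self' (fun _ _ => hlam) x⟩)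
    (fun x hx => Set.indicator_of_notMem (by simpa using hx.le) _)
  rw [interaction, integral_prod _ hi, ← integral_indicator measurableSet_ball,
    ← integral_const_mul]
  refine integral_congr_ae (ae_of_all _ fun x => ?_)
  by_cases hx : x ∈ ball (0 : E2) ε
  · simp only [Set.indicator_of_mem hx]
    rw [← integral_indicator measurableSet_ball, ← integral_const_mul]
    refine integral_congr_ae (ae_of_all _ fun y => ?_)
    by_cases hy : y ∈ ball (0 : E2) ε
    · simp only [Set.indicator_of_mem hy]
      ring
    · simp only [Set.indicator_of_notMem hy, mul_zero]
  · simp only [Set.indicator_of_notMem hx, zero_mul, mul_zero, integral_zero]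

end LogKernel

theorem rearrangement_log_energy_bound
    (lam κ ε : ℝ) (hlam : 0 < lam) (hκ : 0 < κ) (hε : 0 < ε)
    (harea : lam * π * ε ^ 2 = κ)
    (ω : E2 → ℝ) (hmeas : Measurable ω)
    (hbound : ∀ᵐ x : E2 ∂volume, 0 ≤ ω x ∧ ω x ≤ lam)
    (hsupp : ∃ K : Set E2, IsCompact K ∧ ∀ᵐ x : E2 ∂volume, x ∉ K → ω x = 0)
    (hmass : (∫ x : E2, ω x) = κ) :
    (∫ x : E2, ∫ y : E2, Real.log (1 / dist x y) * (ω x * ω y)) ≤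
      lam ^ 2 * ∫ x in ball (0 : E2) ε, ∫ y in ball (0 : E2) ε, Real.log (1 / dist x y) := by
  obtain ⟨K, hK, hωK⟩ := hsupp
  obtain ⟨R, hKR⟩ := hK.isBounded.subset_closedBall 0
  set η : E2 → ℝ := (closedBall (0 : E2) R).indicator fun x => max 0 (min lam (ω x)) with hη
  have hηm : Measurable η :=
    (measurable_const.max (measurable_const.min hmeas)).indicator measurableSet_closedBall
  have h01 : ∀ x, 0 ≤ η x ∧ η x ≤ lam := fun x =>
    ⟨Set.indicator_nonneg (fun _ _ => le_max_left _ _) x,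
      Set.indicator_le' (fun _ _ => max_le hlam.le (min_le_left _ _)) (fun _ _ => hlam.le) x⟩
  have hR : ∀ x, R < ‖x‖ → η x = 0 := fun x hx =>
    Set.indicator_of_notMem (by simpa using hx) _
  have hae : ω =ᵐ[volume] η := by
    filter_upwards [hbound, hωK] with x hx hxK
    by_cases hxR : x ∈ closedBall (0 : E2) R
    · rw [hη, Set.indicator_of_mem hxR, min_eq_right hx.2, max_eq_right hx.1]
    · rw [hη, Set.indicator_of_notMem hxR, hxK fun h => hxR (hKR h)]
  have hηmass : ∫ x, η x = ∫ x, (ball (0 : E2) ε).indicator (fun _ => lam) x := by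
    rw [← integral_congr_ae hae, hmass, integral_indicator measurableSet_ball, setIntegral_const,
      measureReal_def, EuclideanSpace.volume_ball_fin_two, ← harea, ENNReal.toReal_mul,
      ENNReal.toReal_pow, ENNReal.toReal_ofReal hε.le, ENNReal.toReal_ofReal pi_pos.le,
      smul_eq_mul]
    ring
  have hiter : ∫ x, ∫ y, Real.log (1 / dist x y) * (ω x * ω y) =
      interaction (fun r => Real.log (1 / r)) η η := by
    rw [interaction, integral_prod _ (integrable_log_interaction hηm h01 hR)]
    refine integral_congr_ae ?_
    filter_upwards [hae] with x hx
    refine integral_congr_ae ?_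
    filter_upwards [hae] with y hy
    rw [hx, hy]
  rw [hiter, ← interaction_log_indicator_ball hlam.le]
  exact log_interaction_le_interaction_ball hηm h01 hR hε.le hηmass
end
end

section
/- First variation of the energy along an area-preserving flow: let ω ∈ L^∞(D) with essential support compactly contained in D, let φ ∈ C_c^∞(D), and let Φ_t be the flow of the vector field J∇φ (so Φ_0 = id, dΦ_t(x)/dt = J∇φ(Φ_t(x))). Set ω_t := ω∘Φ_{−t}, ψ(x) = ∫_D G(x,y)ω(y)dy and E(ω_t) = (1/2)∫_D∫_D G(x,y)ω_t(x)ω_t(y)dxdy. Then ψ is continuously differentiable on D, the function t ↦ E(ω_t) is differentiable at t = 0, and d/dt E(ω_t)|_{t=0} = ∫_D ω(x)·∂(ψ(x), φ(x)) dx, where ∂(f,g) := ∂_1f·∂_2g − ∂_2f·∂_1g. -/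
open MeasureTheory Metric Real Filter Topology

noncomputable section

/-- The partial derivative of `f` in the `i`-th coordinate direction. -/
def pd (f : E2 → ℝ) (i : Fin 2) (x : E2) : ℝ :=
  fderiv ℝ f x (EuclideanSpace.single i 1)

/-- The Jacobian bracket `∂(f,g) = ∂₁f ∂₂g − ∂₂f ∂₁g`. -/
def jac (f g : E2 → ℝ) (x : E2) : ℝ :=
  pd f 0 x * pd g 1 x - pd f 1 x * pd g 0 x

/-- The Hamiltonian vector field `J∇φ = (∂₂φ, −∂₁φ)`. -/
def hamVF (φ : E2 → ℝ) (x : E2) : E2 :=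
  (EuclideanSpace.equiv (Fin 2) ℝ).symm ![pd φ 1 x, -(pd φ 0 x)]

section Flow

variable {E : Type*} [NormedAddCommGroup E] [NormedSpace ℝ E] {V : E → E} {L : NNReal}
  {Φ : ℝ → E → E}

lemma flow_unique (hV : LipschitzWith L V) {f g : ℝ → E} (hf : ∀ t, HasDerivAt f (V (f t)) t)
    (hg : ∀ t, HasDerivAt g (V (g t)) t) (h0 : f 0 = g 0) : f = g :=
  ODE_solution_unique_univ (v := fun _ => V) (s := fun _ => Set.univ) (K := L) (t₀ := 0)
    (fun _ => hV.lipschitzOnWith) (fun t => ⟨hf t, trivial⟩) (fun t => ⟨hg t, trivial⟩) h0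

lemma flow_add (hV : LipschitzWith L V) (hΦ0 : ∀ x, Φ 0 x = x)
    (hΦ : ∀ x t, HasDerivAt (fun s => Φ s x) (V (Φ t x)) t) (s t : ℝ) (x : E) :
    Φ (s + t) x = Φ s (Φ t x) := by
  refine congrFun (flow_unique hV (f := fun s => Φ (s + t) x) (g := fun s => Φ s (Φ t x))
    (fun r => ?_) (fun r => hΦ _ r) (by simp [hΦ0])) s
  exact (hΦ x (r + t)).comp_add_const r t

lemma flow_neg_apply (hV : LipschitzWith L V) (hΦ0 : ∀ x, Φ 0 x = x)
    (hΦ : ∀ x t, HasDerivAt (fun s => Φ s x) (V (Φ t x)) t) (t : ℝ) (x : E) :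
    Φ (-t) (Φ t x) = x := by
  rw [← flow_add hV hΦ0 hΦ, neg_add_cancel, hΦ0]

lemma flow_apply_neg (hV : LipschitzWith L V) (hΦ0 : ∀ x, Φ 0 x = x)
    (hΦ : ∀ x t, HasDerivAt (fun s => Φ s x) (V (Φ t x)) t) (t : ℝ) (x : E) :
    Φ t (Φ (-t) x) = x := by
  rw [← flow_add hV hΦ0 hΦ, add_neg_cancel, hΦ0]

lemma flow_eq_self (hV : LipschitzWith L V) (hΦ0 : ∀ x, Φ 0 x = x)
    (hΦ : ∀ x t, HasDerivAt (fun s => Φ s x) (V (Φ t x)) t) {x : E} (hx : V x = 0) (t : ℝ) :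
    Φ t x = x := by
  refine congrFun (flow_unique hV (f := fun s => Φ s x) (g := fun _ => x)
    (fun r => hΦ _ r) (fun r => ?_) (by simp [hΦ0])) t
  simpa [hx] using hasDerivAt_const r x

lemma flow_mem (hV : LipschitzWith L V) (hΦ0 : ∀ x, Φ 0 x = x)
    (hΦ : ∀ x t, HasDerivAt (fun s => Φ s x) (V (Φ t x)) t) {K : Set E}
    (hK : ∀ x ∉ K, V x = 0) {x : E} (hx : x ∈ K) (t : ℝ) : Φ t x ∈ K := by
  by_contra hxt
  have h1 := flow_eq_self hV hΦ0 hΦ (hK _ hxt) (-t)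
  rw [flow_neg_apply hV hΦ0 hΦ] at h1
  exact hxt (h1 ▸ hx)

lemma flow_preimage (hV : LipschitzWith L V) (hΦ0 : ∀ x, Φ 0 x = x)
    (hΦ : ∀ x t, HasDerivAt (fun s => Φ s x) (V (Φ t x)) t) {K : Set E}
    (hK : ∀ x ∉ K, V x = 0) (t : ℝ) : Φ t ⁻¹' K = K := by
  ext x
  refine ⟨fun hx => ?_, fun hx => flow_mem hV hΦ0 hΦ hK hx t⟩
  have := flow_mem hV hΦ0 hΦ hK hx (-t)
  rwa [flow_neg_apply hV hΦ0 hΦ] at this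

lemma flow_lipschitz_of_nonneg (hV : LipschitzWith L V) (hΦ0 : ∀ x, Φ 0 x = x)
    (hΦ : ∀ x t, HasDerivAt (fun s => Φ s x) (V (Φ t x)) t) {t : ℝ} (ht : 0 ≤ t) :
    LipschitzWith (Real.exp (L * t)).toNNReal (Φ t) := by
  refine LipschitzWith.of_dist_le_mul fun x y => ?_
  have := dist_le_of_trajectories_ODE (v := fun _ => V) (K := L) (f := fun s => Φ s x)
    (g := fun s => Φ s y) (a := 0) (b := t) (δ := dist x y) (fun _ => hV)
    (fun s _ => (hΦ x s).continuousAt.continuousWithinAt)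
    (fun s _ => (hΦ x s).hasDerivWithinAt)
    (fun s _ => (hΦ y s).continuousAt.continuousWithinAt)
    (fun s _ => (hΦ y s).hasDerivWithinAt) (by simp [hΦ0]) t ⟨ht, le_rfl⟩
  rw [Real.coe_toNNReal _ (Real.exp_pos _).le, mul_comm]
  simpa using this

lemma flow_lipschitz (hV : LipschitzWith L V) (hΦ0 : ∀ x, Φ 0 x = x)
    (hΦ : ∀ x t, HasDerivAt (fun s => Φ s x) (V (Φ t x)) t) (t : ℝ) :
    LipschitzWith (Real.exp (L * |t|)).toNNReal (Φ t) := by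
  rcases le_total 0 t with ht | ht
  · simpa [abs_of_nonneg ht] using flow_lipschitz_of_nonneg hV hΦ0 hΦ ht
  · have := flow_lipschitz_of_nonneg (V := fun x => - V x) (Φ := fun s x => Φ (-s) x) (L := L)
      hV.neg (by simp [hΦ0]) (fun x s => ?_) (neg_nonneg.2 ht)
    · simpa [abs_of_nonpos ht] using this
    · have := (hΦ x (-s)).scomp s (hasDerivAt_neg s)
      simpa [Function.comp_def] using this

/-- The time `t` map of the flow of a Lipschitz vector field, as a homeomorphism. -/
def flowHomeomorph (hV : LipschitzWith L V) (hΦ0 : ∀ x, Φ 0 x = x)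
    (hΦ : ∀ x t, HasDerivAt (fun s => Φ s x) (V (Φ t x)) t) (t : ℝ) : E ≃ₜ E where
  toFun := Φ t
  invFun := Φ (-t)
  left_inv := flow_neg_apply hV hΦ0 hΦ t
  right_inv := flow_apply_neg hV hΦ0 hΦ t
  continuous_toFun := (flow_lipschitz hV hΦ0 hΦ t).continuous
  continuous_invFun := (flow_lipschitz hV hΦ0 hΦ (-t)).continuous

end Flow

lemma hamVF_eq (φ : E2 → ℝ) (x : E2) :
    hamVF φ x = pd φ 1 x • EuclideanSpace.single 0 1 - pd φ 0 x • EuclideanSpace.single 1 1 := by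
  ext i
  fin_cases i <;> simp [hamVF]

lemma apply_hamVF (φ : E2 → ℝ) (x : E2) (ℓ : E2 →L[ℝ] ℝ) :
    ℓ (hamVF φ x) = ℓ (EuclideanSpace.single 0 1) * pd φ 1 x -
      ℓ (EuclideanSpace.single 1 1) * pd φ 0 x := by
  rw [hamVF_eq, map_sub, map_smul, map_smul, smul_eq_mul, smul_eq_mul, mul_comm,
    mul_comm (pd φ 0 x)]

lemma contDiff_pd {φ : E2 → ℝ} (hφ : ContDiff ℝ (⊤ : ℕ∞) φ) (i : Fin 2) :
    ContDiff ℝ (⊤ : ℕ∞) (pd φ i) :=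
  (hφ.fderiv_right (m := (⊤ : ℕ∞)) (by simp)).clm_apply contDiff_const

lemma pd_eq_zero {φ : E2 → ℝ} (i : Fin 2) {x : E2} (hx : x ∉ tsupport φ) : pd φ i x = 0 := by
  simp [pd, fderiv_of_notMem_tsupport ℝ hx]

lemma hasCompactSupport_pd {φ : E2 → ℝ} (hφ : HasCompactSupport φ) (i : Fin 2) :
    HasCompactSupport (pd φ i) :=
  HasCompactSupport.intro hφ fun _ hx => pd_eq_zero i hx

lemma hamVF_eq_zero {φ : E2 → ℝ} {x : E2} (hx : x ∉ tsupport φ) : hamVF φ x = 0 := by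
  simp [hamVF_eq, pd_eq_zero _ hx]

lemma contDiff_hamVF {φ : E2 → ℝ} (hφ : ContDiff ℝ (⊤ : ℕ∞) φ) :
    ContDiff ℝ (⊤ : ℕ∞) (hamVF φ) := by
  have : hamVF φ = fun x => pd φ 1 x • EuclideanSpace.single 0 1
      - pd φ 0 x • EuclideanSpace.single 1 1 := funext (hamVF_eq φ)
  rw [this]
  exact ((contDiff_pd hφ 1).smul contDiff_const).sub ((contDiff_pd hφ 0).smul contDiff_const)

lemma hasCompactSupport_hamVF {φ : E2 → ℝ} (hφ : HasCompactSupport φ) :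
    HasCompactSupport (hamVF φ) :=
  HasCompactSupport.intro hφ fun _ hx => hamVF_eq_zero hx

lemma exists_lipschitzWith_hamVF {φ : E2 → ℝ} (hφ : ContDiff ℝ (⊤ : ℕ∞) φ)
    (hφs : HasCompactSupport φ) : ∃ L, LipschitzWith L (hamVF φ) :=
  (contDiff_hamVF hφ).lipschitzWith_of_hasCompactSupport (hasCompactSupport_hamVF hφs) (by simp)

lemma exists_bound_hamVF {φ : E2 → ℝ} (hφ : ContDiff ℝ (⊤ : ℕ∞) φ)
    (hφs : HasCompactSupport φ) : ∃ C, ∀ x, ‖hamVF φ x‖ ≤ C :=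
  (hasCompactSupport_hamVF hφs).exists_bound_of_continuous (contDiff_hamVF hφ).continuous

lemma pd_pd_comm {φ : E2 → ℝ} (hφ : ContDiff ℝ (⊤ : ℕ∞) φ) (x : E2) :
    pd (pd φ 1) 0 x = pd (pd φ 0) 1 x := by
  have hd : DifferentiableAt ℝ (fderiv ℝ φ) x :=
    ((hφ.fderiv_right (m := (⊤ : ℕ∞)) (by simp)).differentiable (by simp)) x
  have key : ∀ i j, pd (pd φ i) j x = fderiv ℝ (fderiv ℝ φ) x (EuclideanSpace.single j 1)
      (EuclideanSpace.single i 1) := by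
    intro i j
    have := (hd.hasFDerivAt.clm_apply (hasFDerivAt_const (EuclideanSpace.single i (1:ℝ)) x)).fderiv
    simp only [pd]
    rw [show (fun x => fderiv ℝ φ x (EuclideanSpace.single i (1:ℝ))) = _ from rfl] at this
    change fderiv ℝ (fun y => fderiv ℝ φ y (EuclideanSpace.single i (1:ℝ))) x _ = _
    rw [this]
    simp
  rw [key, key]
  exact (hφ.contDiffAt.isSymmSndFDerivAt
    (by simpa using WithTop.coe_le_coe.2 (le_top : (2 : ℕ∞) ≤ ⊤))).eq _ _

/-- The divergence theorem for a Lipschitz function and a Hamiltonian vector field. -/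
lemma integral_fderiv_hamVF_eq_zero {φ : E2 → ℝ} (hφ : ContDiff ℝ (⊤ : ℕ∞) φ)
    (hφs : HasCompactSupport φ) {F : E2 → ℝ} {C : NNReal} (hF : LipschitzWith C F) :
    ∫ x, fderiv ℝ F x (hamVF φ x) = 0 := by
  have hlip : ∀ i, ∃ L, LipschitzWith L (pd φ i) := fun i =>
    (contDiff_pd hφ i).lipschitzWith_of_hasCompactSupport (hasCompactSupport_pd hφs i) (by simp)
  have hcont : ∀ i, Continuous (pd φ i) := fun i => (contDiff_pd hφ i).continuous
  have hint : ∀ i j, Integrable fun x => lineDeriv ℝ F x (EuclideanSpace.single i 1) * pd φ j x := by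
    intro i j
    have h1 := hF.memLp_lineDeriv (μ := volume) (EuclideanSpace.single i (1:ℝ) : E2)
    have h2 : Integrable (pd φ j) :=
      (hcont j).integrable_of_hasCompactSupport (hasCompactSupport_pd hφs j)
    exact h2.bdd_mul h1.aestronglyMeasurable
      (.of_forall fun x => norm_lineDeriv_le_of_lipschitz ℝ hF)
  have hae : (fun x => fderiv ℝ F x (hamVF φ x)) =ᵐ[volume] fun x =>
      lineDeriv ℝ F x (EuclideanSpace.single 0 1) * pd φ 1 x -
      lineDeriv ℝ F x (EuclideanSpace.single 1 1) * pd φ 0 x := by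
    filter_upwards [hF.ae_differentiableAt] with x hx
    rw [apply_hamVF, hx.lineDeriv_eq_fderiv, hx.lineDeriv_eq_fderiv]
  rw [integral_congr_ae hae, integral_sub (hint _ _) (hint _ _)]
  obtain ⟨L0, h0⟩ := hlip 0
  obtain ⟨L1, h1⟩ := hlip 1
  rw [hF.integral_lineDeriv_mul_eq h1 (hasCompactSupport_pd hφs 1),
    hF.integral_lineDeriv_mul_eq h0 (hasCompactSupport_pd hφs 0), sub_eq_zero]
  refine integral_congr_ae (.of_forall fun x => ?_)
  have hd : ∀ i, DifferentiableAt ℝ (pd φ i) x := fun i =>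
    (contDiff_pd hφ i).differentiable (by simp) x
  have := pd_pd_comm hφ x
  simp only [pd] at this
  simp only [(hd _).lineDeriv_eq_fderiv, map_neg]
  change -(pd (pd φ 1) 0 x) * F x = -(pd (pd φ 0) 1 x) * F x
  rw [pd_pd_comm hφ]

section Hamiltonian

variable {φ : E2 → ℝ} {Φ : ℝ → E2 → E2}

lemma hasDerivAt_integral_comp_flow (hφ : ContDiff ℝ (⊤ : ℕ∞) φ) (hφs : HasCompactSupport φ)
    (hΦ0 : ∀ x, Φ 0 x = x) (hΦ : ∀ x t, HasDerivAt (fun s => Φ s x) (hamVF φ (Φ t x)) t)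
    {F : E2 → ℝ} {C : NNReal} (hF : LipschitzWith C F) (hFs : HasCompactSupport F) :
    HasDerivAt (fun t => ∫ x, F (Φ t x)) 0 0 := by
  obtain ⟨L, hL⟩ := exists_lipschitzWith_hamVF hφ hφs
  obtain ⟨B, hB⟩ := exists_bound_hamVF hφ hφs
  have hB0 : 0 ≤ B := (norm_nonneg _).trans (hB 0)
  have hlip : ∀ x, LipschitzWith B.toNNReal (fun s => Φ s x) := fun x =>
    lipschitzWith_of_nnnorm_deriv_le (fun s => (hΦ x s).differentiableAt) fun s => by
      rw [(hΦ x s).deriv, ← NNReal.coe_le_coe, Real.coe_toNNReal _ hB0]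
      exact hB _
  have hdiv := integral_fderiv_hamVF_eq_zero hφ hφs hF
  suffices H : HasDerivAt (fun t => ∫ x, F (Φ t x)) (∫ x, fderiv ℝ F x (hamVF φ x)) 0 by
    rwa [hdiv] at H
  refine (hasDerivAt_integral_of_dominated_loc_of_lip (μ := volume) (s := Set.univ)
    (bound := (tsupport φ).indicator fun _ => (C : ℝ) * B) univ_mem
    (.of_forall fun t => ?_) ?_ ?_ (.of_forall fun x => ?_) ?_ ?_).2
  · exact (hF.continuous.comp (flow_lipschitz hL hΦ0 hΦ t).continuous).aestronglyMeasurable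
  · simpa [hΦ0] using hF.continuous.integrable_of_hasCompactSupport hFs
  · simp only [apply_hamVF]
    exact (((measurable_fderiv_apply_const ℝ F _).mul (contDiff_pd hφ 1).continuous.measurable).sub
      ((measurable_fderiv_apply_const ℝ F _).mul
        (contDiff_pd hφ 0).continuous.measurable)).aestronglyMeasurable
  · by_cases hx : x ∈ tsupport φ
    · rw [Set.indicator_of_mem hx]
      refine ((hF.comp (hlip x)).weaken ?_).lipschitzOnWith
      rw [← NNReal.coe_le_coe]
      simp [hB0]
    · simp only [flow_eq_self hL hΦ0 hΦ (hamVF_eq_zero hx)]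
      exact (LipschitzWith.const' _).lipschitzOnWith
  · exact (integrable_indicator_iff (isClosed_tsupport φ).measurableSet).2
      (integrableOn_const hφs.isCompact.measure_lt_top.ne)
  · filter_upwards [hF.ae_differentiableAt] with x hx
    have h1 : HasFDerivAt F (fderiv ℝ F x) (Φ 0 x) := by rw [hΦ0]; exact hx.hasFDerivAt
    have h2 := h1.comp_hasDerivAt (0:ℝ) (hΦ x 0)
    simpa [hΦ0, Function.comp_def] using h2

lemma integral_comp_flow (hφ : ContDiff ℝ (⊤ : ℕ∞) φ) (hφs : HasCompactSupport φ)
    (hΦ0 : ∀ x, Φ 0 x = x) (hΦ : ∀ x t, HasDerivAt (fun s => Φ s x) (hamVF φ (Φ t x)) t)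
    {F : E2 → ℝ} {C : NNReal} (hF : LipschitzWith C F) (hFs : HasCompactSupport F) (t : ℝ) :
    ∫ x, F (Φ t x) = ∫ x, F x := by
  obtain ⟨L, hL⟩ := exists_lipschitzWith_hamVF hφ hφs
  have hd : ∀ t, HasDerivAt (fun t => ∫ x, F (Φ t x)) 0 t := by
    intro t
    have h1 := hasDerivAt_integral_comp_flow hφ hφs hΦ0 hΦ
      (hF.comp (flow_lipschitz hL hΦ0 hΦ t))
      (hFs.comp_homeomorph (flowHomeomorph hL hΦ0 hΦ t))
    have h2 : HasDerivAt (fun s => ∫ x, F (Φ t (Φ (s - t) x))) 0 t := by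
      have h1' : HasDerivAt (fun t_1 => ∫ x, (F ∘ Φ t) (Φ t_1 x)) 0 (t - t) := by
        rwa [sub_self]
      exact h1'.comp_sub_const t t
    refine h2.congr_of_eventuallyEq (.of_forall fun s => ?_)
    refine integral_congr_ae (.of_forall fun x => ?_)
    simp only
    rw [← flow_add hL hΦ0 hΦ, add_sub_cancel]
  have := is_const_of_deriv_eq_zero (fun t => (hd t).differentiableAt) (fun t => (hd t).deriv) t 0
  simpa [hΦ0] using this

/-- Liouville's theorem: Hamiltonian flows preserve area. -/
lemma measurePreserving_flow (hφ : ContDiff ℝ (⊤ : ℕ∞) φ) (hφs : HasCompactSupport φ)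
    (hΦ0 : ∀ x, Φ 0 x = x) (hΦ : ∀ x t, HasDerivAt (fun s => Φ s x) (hamVF φ (Φ t x)) t)
    (t : ℝ) : MeasurePreserving (Φ t) (volume : Measure E2) volume := by
  obtain ⟨L, hL⟩ := exists_lipschitzWith_hamVF hφ hφs
  have hcont : Continuous (Φ t) := (flow_lipschitz hL hΦ0 hΦ t).continuous
  have hmeas : Measurable (Φ t) := hcont.measurable
  refine ⟨hmeas, ?_⟩
  have hreg : (Measure.map (Φ t) (volume : Measure E2)).Regular :=
    Measure.Regular.map (flowHomeomorph hL hΦ0 hΦ t)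
  refine Measure.OuterRegular.ext_isOpen_isBounded fun U hU hUb => ?_
  have hne : (Uᶜ).Nonempty := by
    rw [Set.nonempty_compl]
    rintro rfl
    exact NormedSpace.unbounded_univ ℝ E2 hUb
  let g : ℕ → E2 → ℝ := fun n x => min 1 (n * infDist x Uᶜ)
  have hg0 : ∀ n x, 0 ≤ g n x := fun n x =>
    le_min zero_le_one (mul_nonneg n.cast_nonneg infDist_nonneg)
  have hglip : ∀ n : ℕ, LipschitzWith (n : NNReal) (g n) := by
    intro n
    have h1 : LipschitzWith (n : NNReal) fun x : E2 => (n : ℝ) * infDist x Uᶜ := by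
      refine LipschitzWith.of_dist_le_mul fun x y => ?_
      rw [Real.dist_eq, ← mul_sub, abs_mul, Nat.abs_cast, ← Real.dist_eq]
      exact mul_le_mul_of_nonneg_left (by simpa using (lipschitz_infDist_pt Uᶜ).dist_le_mul x y)
        n.cast_nonneg
    exact h1.const_min 1
  have hgout : ∀ n, ∀ x ∉ U, g n x = 0 := by
    intro n x hx
    simp [g, infDist_zero_of_mem (show x ∈ Uᶜ from hx)]
  have hgs : ∀ n, HasCompactSupport (g n) := fun n =>
    HasCompactSupport.intro hUb.isCompact_closure fun x hx => hgout n x (fun h => hx (subset_closure h))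
  have hmono : ∀ x, Monotone fun n => ENNReal.ofReal (g n x) := by
    intro x n m hnm
    refine ENNReal.ofReal_le_ofReal (min_le_min le_rfl ?_)
    exact mul_le_mul_of_nonneg_right (by exact_mod_cast hnm) infDist_nonneg
  have hlim : ∀ x, Tendsto (fun n => ENNReal.ofReal (g n x)) atTop (𝓝 (U.indicator 1 x)) := by
    intro x
    by_cases hx : x ∈ U
    · have hpos : 0 < infDist x Uᶜ :=
        (hU.isClosed_compl.notMem_iff_infDist_pos hne).1 (by simpa using hx)
      rw [Set.indicator_of_mem hx]
      refine tendsto_const_nhds.congr' ?_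
      obtain ⟨N, hN⟩ := exists_nat_ge (infDist x Uᶜ)⁻¹
      filter_upwards [eventually_ge_atTop N] with n hn
      have : (1 : ℝ) ≤ n * infDist x Uᶜ := by
        rw [← inv_mul_cancel₀ hpos.ne']
        exact mul_le_mul_of_nonneg_right (hN.trans (by exact_mod_cast hn)) hpos.le
      simp [g, min_eq_left this]
    · simp [Set.indicator_of_notMem hx, hgout _ x hx]
  have key : ∀ μ : Measure E2, Tendsto (fun n => ∫⁻ x, ENNReal.ofReal (g n x) ∂μ) atTop (𝓝 (μ U)) := by
    intro μ
    have := lintegral_tendsto_of_tendsto_of_monotone (μ := μ)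
      (fun n => ((hglip n).continuous.measurable.ennreal_ofReal).aemeasurable)
      (.of_forall hmono) (.of_forall hlim)
    rwa [lintegral_indicator_one hU.measurableSet] at this
  refine tendsto_nhds_unique (key _) ((key volume).congr fun n => ?_)
  rw [lintegral_map (hglip n).continuous.measurable.ennreal_ofReal hmeas,
    ← ofReal_integral_eq_lintegral_ofReal
      ((hglip n).continuous.integrable_of_hasCompactSupport (hgs n)) (.of_forall (hg0 n)),
    ← ofReal_integral_eq_lintegral_ofReal (f := fun x => g n (Φ t x))
      (((hglip n).continuous.comp hcont).integrable_of_hasCompactSupport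
        ((hgs n).comp_homeomorph (flowHomeomorph hL hΦ0 hΦ t))) (.of_forall fun x => hg0 n _)]
  exact congrArg _ (integral_comp_flow hφ hφs hΦ0 hΦ (hglip n) (hgs n) t).symm

end Hamiltonian

lemma setIntegral_closedBall_mul_radial_complex {u : ℂ → ℝ} {c : ℂ} {r : ℝ}
    (hu : InnerProductSpace.HarmonicOnNhd u (closedBall c r)) {g : ℝ → ℝ} (hg : Continuous g) :
    ∫ z in closedBall (0 : ℂ) r, u (c - z) * g ‖z‖ = u c * ∫ z in closedBall (0 : ℂ) r, g ‖z‖ := by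
  set B := closedBall (0 : ℂ) r with hB
  set A := ∫ z in B, u (c - z) * g ‖z‖ with hA
  have hrot : ∀ θ : ℝ, ∫ z in B, u (c - Complex.exp (θ * Complex.I) * z) * g ‖z‖ = A := by
    intro θ
    let e := rotation (Circle.exp θ)
    have he : ∀ z, e z = Complex.exp (θ * Complex.I) * z := fun z => by
      simp [e, rotation_apply, Circle.coe_exp]
    have hpre : e ⁻¹' B = B := by ext z; simp [hB]
    have := e.measurePreserving.setIntegral_preimage_emb
      e.toHomeomorph.toMeasurableEquiv.measurableEmbedding (fun z => u (c - z) * g ‖z‖) B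
    rw [hpre] at this
    rw [hA, ← this]
    refine integral_congr_ae (.of_forall fun z => ?_)
    simp only [he, norm_mul, Complex.norm_exp_ofReal_mul_I, one_mul]
  have hcirc : ∀ z ∈ B, ∫ θ in (0 : ℝ)..2 * π, u (c - Complex.exp (θ * Complex.I) * z) * g ‖z‖
      = 2 * π * (u c * g ‖z‖) := by
    intro z hz
    have h1 : circleAverage u c (-‖z‖) = u c := by
      refine InnerProductSpace.HarmonicOnNhd.circleAverage_eq (hu.mono ?_)
      exact closedBall_subset_closedBall (by simpa [hB] using hz)
    rw [circleAverage_eq_integral_add z.arg, smul_eq_mul, inv_mul_eq_iff_eq_mul₀ (by positivity)] at h1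
    rw [intervalIntegral.integral_mul_const, ← mul_assoc, ← h1]
    congr 1
    refine intervalIntegral.integral_congr fun θ _ => ?_
    simp only [circleMap]
    congr 1
    rw [sub_eq_add_neg, add_right_inj]
    push_cast
    rw [add_mul, Complex.exp_add]
    nth_rewrite 1 [← Complex.norm_mul_exp_arg_mul_I z]
    ring
  have hpi : (0 : ℝ) ≤ 2 * π := by positivity
  have hswap : ∫ θ in Set.Ioc 0 (2 * π), ∫ z in B, u (c - Complex.exp (θ * Complex.I) * z) * g ‖z‖
      = ∫ z in B, ∫ θ in Set.Ioc 0 (2 * π), u (c - Complex.exp (θ * Complex.I) * z) * g ‖z‖ := by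
    refine integral_integral_swap ?_
    rw [Measure.prod_restrict]
    refine IntegrableOn.mono_set (t := Set.Icc 0 (2 * π) ×ˢ B) ?_
      (Set.prod_mono Set.Ioc_subset_Icc_self le_rfl)
    refine ContinuousOn.integrableOn_compact
      (isCompact_Icc.prod (isCompact_closedBall _ _)) ?_
    refine ContinuousOn.mul ?_ (by fun_prop)
    refine hu.continuousOn.comp (by fun_prop) ?_
    rintro ⟨θ, z⟩ ⟨-, hz⟩
    simpa [hB] using hz
  have hfin : 2 * π * A = 2 * π * (u c * ∫ z in B, g ‖z‖) := by
    have h1 : ∫ θ in Set.Ioc 0 (2 * π),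
        ∫ z in B, u (c - Complex.exp (θ * Complex.I) * z) * g ‖z‖ = 2 * π * A := by
      simp [hrot, hpi]
    rw [← h1, hswap, ← integral_const_mul, ← integral_const_mul]
    refine setIntegral_congr_fun measurableSet_closedBall fun z hz => ?_
    rw [← hcirc z hz, intervalIntegral.integral_of_le hpi]
  exact mul_left_cancel₀ (by positivity) hfin

lemma integral_mul_radial_eq {f : E2 → ℝ} {D : Set E2} (hD : IsOpen D)
    (hf : ContDiffOn ℝ 2 f D)
    (hΔ : ∀ x ∈ D, ∑ i : Fin 2, iteratedFDerivWithin ℝ 2 f D x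
      ![EuclideanSpace.single i 1, EuclideanSpace.single i 1] = 0)
    {x : E2} {r : ℝ} (hx : closedBall x r ⊆ D) {g : ℝ → ℝ} (hg : Continuous g)
    (hgr : ∀ s, r < s → g s = 0) :
    ∫ z, f (x - z) * g ‖z‖ = f x * ∫ z : E2, g ‖z‖ := by
  let T := Complex.orthonormalBasisOneI.repr
  have hharm : ∀ z, T z ∈ D → InnerProductSpace.HarmonicAt (f ∘ T) z := by
    intro z hz
    have hopen : IsOpen (T ⁻¹' D) := hD.preimage T.continuous
    refine ⟨?_, ?_⟩
    · exact (hf.contDiffAt (hD.mem_nhds hz)).comp z T.contDiff.contDiffAt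
    · filter_upwards [hopen.mem_nhds hz] with w hw
      have h1 := hΔ (T w) hw
      rw [InnerProductSpace.laplacian_eq_iteratedFDeriv_orthonormalBasis _
        Complex.orthonormalBasisOneI]
      simp only [Pi.zero_apply]
      rw [← h1]
      refine Finset.sum_congr rfl fun i _ => ?_
      rw [iteratedFDerivWithin_of_isOpen 2 hD hw]
      have h2 : iteratedFDerivWithin ℝ 2 (f ∘ T) (T ⁻¹' D) w =
          (iteratedFDerivWithin ℝ 2 f D (T w)).compContinuousLinearMap fun _ =>
            T.toContinuousLinearEquiv.toContinuousLinearMap :=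
        T.toContinuousLinearEquiv.toContinuousLinearMap.iteratedFDerivWithin_comp_right
        hf hD.uniqueDiffOn (hopen.uniqueDiffOn) (x := w) hw (i := 2) le_rfl
      rw [iteratedFDerivWithin_of_isOpen 2 hopen hw, iteratedFDerivWithin_of_isOpen 2 hD hw] at h2
      have h3 := congrArg (fun m => m ![Complex.orthonormalBasisOneI i, Complex.orthonormalBasisOneI i]) h2
      simp only [ContinuousMultilinearMap.compContinuousLinearMap_apply] at h3
      refine h3.trans ?_
      congr 1
      ext j k
      fin_cases i <;> fin_cases j <;> fin_cases k <;> simp [T]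
  have key := setIntegral_closedBall_mul_radial_complex (u := f ∘ T) (c := T.symm x) (r := r)
    (fun z hz => hharm z (hx (by
      rw [mem_closedBall, ← T.symm.dist_map, T.symm_apply_apply]; exact hz))) hg
  have hout : ∀ z ∉ closedBall (0 : ℂ) r, g ‖z‖ = 0 := fun z hz => hgr _ (by simpa using hz)
  rw [setIntegral_eq_integral_of_forall_compl_eq_zero (fun z hz => hout z hz),
    setIntegral_eq_integral_of_forall_compl_eq_zero
      (fun z hz => by rw [hout z hz, mul_zero])] at key
  have hT := T.measurePreserving
  have hTe := T.toHomeomorph.toMeasurableEquiv.measurableEmbedding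
  have e1 := hT.integral_comp hTe (fun z => f (x - z) * g ‖z‖)
  have e2 := hT.integral_comp hTe (fun z => g ‖z‖)
  rw [← e1, ← e2]
  simpa using key

/-- A kernel that is continuous, symmetric and harmonic in each variable agrees on every compact
set with a globally defined symmetric `C^1` kernel. -/
lemma exists_contDiff_symm_kernel {D : Set E2} (hDopen : IsOpen D) {h : E2 → E2 → ℝ}
    (hcont : ContinuousOn (fun q : E2 × E2 => h q.1 q.2) (D ×ˢ D))
    (hsymm : ∀ x ∈ D, ∀ y ∈ D, h x y = h y x)
    (hharm : ∀ y ∈ D, ContDiffOn ℝ 2 (fun x => h x y) D ∧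
      ∀ x ∈ D, ∑ i : Fin 2,
        iteratedFDerivWithin ℝ 2 (fun x' => h x' y) D x
          ![EuclideanSpace.single i 1, EuclideanSpace.single i 1] = 0)
    {C : Set E2} (hC : IsCompact C) (hCD : C ⊆ D) :
    ∃ k : E2 × E2 → ℝ, ContDiff ℝ 1 k ∧ (∀ p, k p.swap = k p) ∧
      ∀ x ∈ C, ∀ y ∈ C, k (x, y) = h x y := by
  obtain ⟨r, hr, hrD⟩ := hC.exists_cthickening_subset_open hDopen hCD
  set C' := cthickening r C with hC'
  have hC'c : IsCompact C' := hC.cthickening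
  have hsub : ∀ x ∈ C, ∀ z : E2, ‖z‖ ≤ r → x - z ∈ C' := fun x hx z hz =>
    closedBall_subset_cthickening hx r (by simpa using hz)
  have hball : ∀ x ∈ C, closedBall x r ⊆ D := fun x hx =>
    (closedBall_subset_cthickening hx r).trans hrD
  let g : ℝ → ℝ := fun s => expNegInvGlue (r ^ 2 - s ^ 2)
  have hgc : Continuous g := (expNegInvGlue.contDiff (n := 1)).continuous.comp (by fun_prop)
  have hg0 : ∀ s, r < s → g s = 0 := fun s hs =>
    expNegInvGlue.zero_of_nonpos (by nlinarith)
  let η : E2 → ℝ := fun z => g ‖z‖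
  have hη : ContDiff ℝ 1 η :=
    expNegInvGlue.contDiff.comp (contDiff_const.sub (contDiff_norm_sq ℝ))
  have hη0 : ∀ z : E2, r < ‖z‖ → η z = 0 := fun z hz => hg0 _ hz
  have hηs : HasCompactSupport η := HasCompactSupport.intro (isCompact_closedBall 0 r)
    fun z hz => hη0 z (by simpa using hz)
  set I := ∫ z, η z with hI
  have hIpos : 0 < I := by
    refine hη.continuous.integral_pos_of_hasCompactSupport_nonneg_nonzero (x := 0) hηs
      (fun z => expNegInvGlue.nonneg _) ?_
    exact (expNegInvGlue.pos_of_pos (by simpa using pow_pos hr 2)).ne'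
  let ρ : E2 × E2 → ℝ := fun p => η p.1 * η p.2
  have hρ : ContDiff ℝ 1 ρ := (hη.comp contDiff_fst).mul (hη.comp contDiff_snd)
  have hρs : HasCompactSupport ρ :=
    HasCompactSupport.intro ((isCompact_closedBall 0 r).prod (isCompact_closedBall 0 r)) (by
      rintro ⟨a, b⟩ hab
      rw [Set.mem_prod, not_and_or] at hab
      rcases hab with hab | hab
      · simp [ρ, hη0 a (by simpa using hab)]
      · simp [ρ, hη0 b (by simpa using hab)])
  let f : E2 × E2 → ℝ := (C' ×ˢ C').indicator fun q => h q.1 q.2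
  have hf : Integrable f := by
    rw [integrable_indicator_iff (hC'c.isClosed.prod hC'c.isClosed).measurableSet]
    exact (hcont.mono (Set.prod_mono hrD hrD)).integrableOn_compact (hC'c.prod hC'c)
  have hfv : ∀ a ∈ C', ∀ b ∈ C', f (a, b) = h a b := fun a ha b hb =>
    Set.indicator_of_mem (Set.mk_mem_prod ha hb) _
  clear_value f
  let k₀ : E2 × E2 → ℝ := convolution f ρ (ContinuousLinearMap.mul ℝ ℝ) volume
  have hk₀ : ContDiff ℝ 1 k₀ :=
    hρs.contDiff_convolution_right (n := 1) _ hf.locallyIntegrable hρ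
  have hval : ∀ x ∈ C, ∀ y ∈ C, k₀ (x, y) = h x y * I ^ 2 := by
    intro x hx y hy
    have : (volume : Measure (E2 × E2)).IsAddHaarMeasure := by
      rw [Measure.volume_eq_prod]; infer_instance
    have : (volume : Measure (E2 × E2)).IsNegInvariant :=
      ⟨((Measure.measurePreserving_neg (volume : Measure E2)).prod
        (Measure.measurePreserving_neg (volume : Measure E2))).map_eq⟩
    have hex : ConvolutionExistsAt f ρ (x, y) (ContinuousLinearMap.mul ℝ ℝ) volume :=
      hρs.convolutionExists_right _ hf.locallyIntegrable hρ.continuous _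
    have hint : Integrable (fun p : E2 × E2 => f ((x, y) - p) * ρ p) (volume.prod volume) :=
      hex.integrable_swap
    have e0 : k₀ (x, y) = ∫ p : E2 × E2, f ((x, y) - p) * ρ p := by
      rw [show k₀ (x, y) = _ from convolution_eq_swap _]
      rfl
    rw [e0, Measure.volume_eq_prod, integral_prod _ hint]
    have inner : ∀ a : E2, ∫ b, f ((x, y) - (a, b)) * ρ (a, b) = (h (x - a) y * η a) * I := by
      intro a
      by_cases ha : ‖a‖ ≤ r
      · have hxa : x - a ∈ D := hrD (hsub x hx a ha)
        have e1 : ∀ b, f ((x, y) - (a, b)) * ρ (a, b) = η a * (h (y - b) (x - a) * g ‖b‖) := by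
          intro b
          by_cases hb : ‖b‖ ≤ r
          · have hyb := hsub y hy b hb
            rw [Prod.mk_sub_mk, hfv _ (hsub x hx a ha) _ hyb, hsymm _ hxa _ (hrD hyb)]
            simp only [ρ, η]; ring
          · have : g ‖b‖ = 0 := hg0 _ (not_le.1 hb)
            simp [ρ, η, this]
        simp_rw [e1]
        rw [integral_const_mul, integral_mul_radial_eq hDopen (hharm _ hxa).1 (hharm _ hxa).2
          (hball y hy) hgc hg0, hsymm _ (hCD hy) _ hxa]
        simp only [hI, η]; ring
      · have : η a = 0 := hη0 a (not_le.1 ha)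
        simp [ρ, this]
    simp_rw [inner]
    rw [integral_mul_const, integral_mul_radial_eq hDopen (hharm y (hCD hy)).1 (hharm y (hCD hy)).2
      (hball x hx) hgc hg0]
    simp only [hI, η]; ring
  refine ⟨fun p => (2 * I ^ 2)⁻¹ * (k₀ p + k₀ p.swap), ?_, fun p => ?_, fun x hx y hy => ?_⟩
  · exact contDiff_const.mul (hk₀.add (hk₀.comp (contDiff_snd.prodMk contDiff_fst)))
  · simp [add_comm]
  · simp only [Prod.swap_prod_mk]
    rw [hval x hx y hy, hval y hy x hx, hsymm y (hCD hy) x (hCD hx)]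
    field_simp
    ring

lemma integrableOn_inv_norm (R : ℝ) : IntegrableOn (fun z : E2 => ‖z‖⁻¹) (ball 0 R) := by
  refine (integrableOn_fun_norm_addHaar (volume : Measure E2) (f := fun s => s⁻¹)).2 ?_
  refine IntegrableOn.congr_fun (f := fun _ => (1 : ℝ)) ?_ (fun y hy => ?_) measurableSet_Ioo
  · exact integrableOn_const (by simp)
  · have : y ≠ 0 := hy.1.ne'
    simp [this]

lemma integrableOn_comp_sub {F : Type*} [NormedAddCommGroup F] {q : E2 → F} {R : ℝ}
    (hq : IntegrableOn q (ball 0 R)) {K : Set E2} {x : E2} (hK : ∀ y ∈ K, x - y ∈ ball (0 : E2) R) :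
    IntegrableOn (fun y => q (x - y)) K := by
  have h := (Measure.measurePreserving_sub_left (volume : Measure E2) x).integrableOn_comp_preimage
    (Homeomorph.subLeft x).measurableEmbedding (f := q) (s := ball 0 R)
  exact (h.2 hq).mono_set hK

lemma setIntegral_comp_sub_le {q : E2 → ℝ} {R : ℝ} (hq0 : ∀ z, 0 ≤ q z)
    (hq : IntegrableOn q (ball 0 R)) {K : Set E2} {x : E2} (hK : ∀ y ∈ K, x - y ∈ ball (0 : E2) R) :
    ∫ y in K, q (x - y) ≤ ∫ z in ball (0 : E2) R, q z := by
  have hm := Measure.measurePreserving_sub_left (volume : Measure E2) x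
  have he := (Homeomorph.subLeft x).measurableEmbedding
  have h := hm.integrableOn_comp_preimage he (f := q) (s := ball 0 R)
  rw [← hm.setIntegral_preimage_emb he q (ball 0 R)]
  exact setIntegral_mono_set (h.2 hq) (.of_forall fun _ => hq0 _) (LE.le.eventuallyLE hK)

lemma norm_setIntegral_le_of_kernel {F : Type*} [NormedAddCommGroup F] [NormedSpace ℝ F]
    {f : E2 → F} {q : E2 → ℝ} {R M : ℝ} (hM : 0 ≤ M) (hq0 : ∀ z, 0 ≤ q z)
    (hq : IntegrableOn q (ball 0 R)) {K : Set E2} {x : E2} (hK : ∀ y ∈ K, x - y ∈ ball (0 : E2) R)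
    (hf : ∀ᵐ y ∂(volume.restrict K), ‖f y‖ ≤ M * q (x - y)) :
    ‖∫ y in K, f y‖ ≤ M * ∫ z in ball (0 : E2) R, q z := by
  refine (norm_integral_le_of_norm_le ((integrableOn_comp_sub hq hK).const_mul M) hf).trans ?_
  rw [integral_const_mul]
  exact mul_le_mul_of_nonneg_left (setIntegral_comp_sub_le hq0 hq hK) hM

lemma exists_forall_sub_mem_ball {A B : Set E2} (hA : Bornology.IsBounded A)
    (hB : Bornology.IsBounded B) : ∃ R, ∀ x ∈ A, ∀ y ∈ B, x - y ∈ ball (0 : E2) R := by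
  obtain ⟨a, ha⟩ := hA.exists_norm_le
  obtain ⟨b, hb⟩ := hB.exists_norm_le
  refine ⟨a + b + 1, fun x hx y hy => ?_⟩
  rw [mem_ball_zero_iff]
  linarith [norm_sub_le x y, ha x hx, hb y hy]

/-- A function on a product of compact sets dominated by `|x - y|⁻¹` is integrable. -/
lemma integrable_inv_norm_sub_prod {K : Set E2} (hK : IsCompact K) :
    Integrable (fun p : E2 × E2 => ‖p.1 - p.2‖⁻¹)
      ((volume.restrict K).prod (volume.restrict K)) := by
  obtain ⟨R, hR⟩ := exists_forall_sub_mem_ball hK.isBounded hK.isBounded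
  have : IsFiniteMeasure (volume.restrict K) := ⟨by simpa using hK.measure_lt_top⟩
  have hm : Measurable (fun p : E2 × E2 => ‖p.1 - p.2‖⁻¹) := by fun_prop
  rw [integrable_prod_iff hm.aestronglyMeasurable]
  have hae : ∀ᵐ x ∂(volume.restrict K), x ∈ K := ae_restrict_mem hK.measurableSet
  refine ⟨hae.mono fun x hx => integrableOn_comp_sub (integrableOn_inv_norm R) (hR x hx), ?_⟩
  refine Integrable.of_bound (C := ∫ z in ball (0 : E2) R, ‖z‖⁻¹)
    hm.norm.aestronglyMeasurable.integral_prod_right' (hae.mono fun x hx => ?_)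
  rw [norm_of_nonneg (integral_nonneg fun _ => norm_nonneg _)]
  simp only [norm_inv, norm_norm]
  exact setIntegral_comp_sub_le (q := fun z => ‖z‖⁻¹) (fun z => by positivity)
    (integrableOn_inv_norm R) (hR x hx)

lemma abs_log_le_div {s R : ℝ} (hs : 0 ≤ s) (hsR : s ≤ R) : |log s| ≤ (R ^ 2 + 1) * s⁻¹ := by
  rcases hs.eq_or_lt with rfl | hs
  · simp
  have h1 := log_le_sub_one_of_pos hs
  have h2 := log_le_sub_one_of_pos (inv_pos.2 hs)
  rw [log_inv] at h2
  have h3 : s ≤ R ^ 2 * s⁻¹ := by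
    rw [← div_eq_mul_inv, le_div_iff₀ hs]; nlinarith
  have h4 : 0 < s⁻¹ := inv_pos.2 hs
  rw [abs_le]
  constructor <;> nlinarith

/-- The gradient of `z ↦ log |z|`, as a linear form. -/
def logGrad (z : E2) : E2 →L[ℝ] ℝ := (‖z‖ ^ 2)⁻¹ • innerSL ℝ z

/-- The gradient of `z ↦ (1/2) log (|z|² + ε²)`, as a linear form. -/
def logGradReg (ε : ℝ) (z : E2) : E2 →L[ℝ] ℝ := (‖z‖ ^ 2 + ε ^ 2)⁻¹ • innerSL ℝ z

lemma norm_logGrad (z : E2) : ‖logGrad z‖ = ‖z‖⁻¹ := by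
  rw [logGrad, norm_smul, innerSL_apply_norm, norm_inv, norm_pow, norm_norm]
  rcases eq_or_ne ‖z‖ 0 with h | h
  · simp [h]
  · field_simp

lemma logGrad_neg (z : E2) : logGrad (-z) = -logGrad z := by
  simp [logGrad]

lemma measurable_logGrad : Measurable logGrad := by
  unfold logGrad
  exact Measurable.smul (f := fun z : E2 => (‖z‖ ^ 2)⁻¹) (by fun_prop)
    (innerSL ℝ (E := E2)).continuous.measurable

lemma hasFDerivAt_log_norm {z : E2} (hz : z ≠ 0) :
    HasFDerivAt (fun z : E2 => log ‖z‖) (logGrad z) z := by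
  have h0 : ‖z‖ ^ 2 ≠ 0 := by positivity
  have h1 := ((hasStrictFDerivAt_norm_sq z).hasFDerivAt.log h0).const_mul (1 / 2)
  refine (h1.congr_fderiv ?_).congr_of_eventuallyEq (.of_forall fun w => ?_)
  · ext v; simp [logGrad]; ring
  · simp only [log_pow]; push_cast; ring

lemma hasFDerivAt_log_reg {ε : ℝ} (hε : 0 < ε) (z : E2) :
    HasFDerivAt (fun z : E2 => 1 / 2 * log (‖z‖ ^ 2 + ε ^ 2)) (logGradReg ε z) z := by
  have h0 : ‖z‖ ^ 2 + ε ^ 2 ≠ 0 := by positivity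
  have h1 := (((hasStrictFDerivAt_norm_sq z).hasFDerivAt.add_const (ε ^ 2)).log h0).const_mul (1 / 2)
  refine h1.congr_fderiv ?_
  ext v; simp [logGradReg]; ring

lemma continuous_logGradReg {ε : ℝ} (hε : 0 < ε) : Continuous (logGradReg ε) := by
  unfold logGradReg
  refine Continuous.smul (f := fun z : E2 => (‖z‖ ^ 2 + ε ^ 2)⁻¹)
    (Continuous.inv₀ (by fun_prop) fun z => ?_) (innerSL ℝ (E := E2)).continuous
  positivity

lemma norm_logGradReg_le {ε : ℝ} (hε : 0 < ε) (z : E2) : ‖logGradReg ε z‖ ≤ ε⁻¹ := by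
  rw [logGradReg, norm_smul, innerSL_apply_norm, norm_of_nonneg (by positivity),
    inv_mul_le_iff₀ (by positivity), ← div_eq_mul_inv, le_div_iff₀ hε]
  nlinarith [sq_nonneg (‖z‖ - ε), norm_nonneg z]

lemma norm_logGradReg_sub_le (ε : ℝ) (z : E2) :
    ‖logGradReg ε z - logGrad z‖ ≤ ε ^ 2 * (‖z‖ ^ 2 + ε ^ 2)⁻¹ * ‖z‖⁻¹ := by
  have h0 : logGradReg ε z - logGrad z =
      ((‖z‖ ^ 2 + ε ^ 2)⁻¹ - (‖z‖ ^ 2)⁻¹) • innerSL ℝ z := by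
    ext v; simp [logGradReg, logGrad]; ring
  rw [h0, norm_smul, innerSL_apply_norm]
  rcases eq_or_ne ‖z‖ 0 with h | h
  · simp [h]
  have h1 : ‖z‖ ^ 2 + ε ^ 2 ≠ 0 := by positivity
  have : (‖z‖ ^ 2 + ε ^ 2)⁻¹ - (‖z‖ ^ 2)⁻¹ = -(ε ^ 2 * (‖z‖ ^ 2 + ε ^ 2)⁻¹ * (‖z‖ ^ 2)⁻¹) := by
    field_simp; ring
  rw [this, norm_neg, norm_of_nonneg (by positivity)]
  refine le_of_eq ?_
  field_simp

lemma abs_log_reg_sub_le {ε : ℝ} (hε : 0 < ε) {z : E2} (hz : z ≠ 0) :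
    |1 / 2 * log (‖z‖ ^ 2 + ε ^ 2) - log ‖z‖| ≤ ε * ‖z‖⁻¹ := by
  have hz' : 0 < ‖z‖ := norm_pos_iff.2 hz
  have h1 : 2 * log ‖z‖ ≤ log (‖z‖ ^ 2 + ε ^ 2) := by
    have := Real.log_pow ‖z‖ 2
    push_cast at this
    rw [← this]
    exact log_le_log (by positivity) (by nlinarith)
  have h2 : log (‖z‖ ^ 2 + ε ^ 2) ≤ 2 * (log ‖z‖ + ε * ‖z‖⁻¹) := by
    have h3 : log (‖z‖ ^ 2 + ε ^ 2) ≤ log ((‖z‖ * (1 + ε * ‖z‖⁻¹)) ^ 2) := by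
      refine log_le_log (by positivity) ?_
      have : ‖z‖ * (1 + ε * ‖z‖⁻¹) = ‖z‖ + ε := by field_simp
      rw [this]; nlinarith
    rw [log_pow, log_mul hz'.ne' (by positivity)] at h3
    push_cast at h3
    have := log_le_sub_one_of_pos (show 0 < 1 + ε * ‖z‖⁻¹ by positivity)
    linarith
  rw [abs_le]
  have : 0 < ε * ‖z‖⁻¹ := by positivity
  constructor <;> linarith

lemma tendsto_integral_logGradReg_sub (R : ℝ) :
    Tendsto (fun n : ℕ => ∫ z in ball (0 : E2) R,
      (1 / ((n : ℝ) + 1)) ^ 2 * (‖z‖ ^ 2 + (1 / ((n : ℝ) + 1)) ^ 2)⁻¹ * ‖z‖⁻¹) atTop (𝓝 0) := by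
  rw [← integral_zero E2 ℝ (μ := volume.restrict (ball (0 : E2) R))]
  refine tendsto_integral_of_dominated_convergence (fun z => ‖z‖⁻¹)
    (fun n => by fun_prop) (integrableOn_inv_norm R) (fun n => .of_forall fun z => ?_)
    (.of_forall fun z => ?_)
  · rw [norm_of_nonneg (by positivity)]
    refine mul_le_of_le_one_left (by positivity) ?_
    rw [← div_eq_mul_inv, div_le_one (by positivity)]
    nlinarith [sq_nonneg ‖z‖]
  · rcases eq_or_ne ‖z‖ 0 with h | h
    · simp [h]
    have h1 : Tendsto (fun n : ℕ => (1 / ((n : ℝ) + 1)) ^ 2) atTop (𝓝 0) := by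
      simpa using (tendsto_one_div_add_atTop_nhds_zero_nat (𝕜 := ℝ)).pow 2
    have h2 := (h1.mul ((h1.const_add (‖z‖ ^ 2)).inv₀ (by positivity))).mul_const ‖z‖⁻¹
    simpa using h2

lemma norm_smul_sub_smul {F : Type*} [NormedAddCommGroup F] [NormedSpace ℝ F] (a : ℝ) (u v : F) :
    ‖a • u - a • v‖ = ‖a‖ * ‖u - v‖ := by
  rw [← smul_sub, norm_smul]

lemma integrableOn_bdd_smul_comp_sub {F : Type*} [NormedAddCommGroup F] [NormedSpace ℝ F]
    {K : Set E2} {w : E2 → ℝ} (hw : Measurable w) {M : ℝ} (hM : ∀ x, |w x| ≤ M)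
    {q : E2 → F} {x : E2} (hq : IntegrableOn (fun y => q (x - y)) K) :
    IntegrableOn (fun y => w y • q (x - y)) K :=
  Integrable.bdd_smul hq M hw.aestronglyMeasurable (.of_forall hM)

lemma integrableOn_logGrad (R : ℝ) : IntegrableOn logGrad (ball 0 R) := by
  refine (integrable_norm_iff measurable_logGrad.aestronglyMeasurable).1 ?_
  simp only [norm_logGrad]
  exact integrableOn_inv_norm R

lemma integrableOn_log_norm (R : ℝ) : IntegrableOn (fun z : E2 => log ‖z‖) (ball 0 R) := by
  refine ((integrableOn_inv_norm R).const_mul (R ^ 2 + 1)).mono'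
    (measurable_log.comp measurable_norm).aestronglyMeasurable ?_
  filter_upwards [ae_restrict_mem measurableSet_ball] with z hz
  exact abs_log_le_div (norm_nonneg z) (mem_ball_zero_iff.1 hz).le

/-- The logarithmic potential of a bounded compactly supported density is continuously
differentiable, and may be differentiated under the integral sign. -/
theorem hasFDerivAt_logPotential {K U : Set E2} (hK : IsCompact K) (hU : IsOpen U)
    (hUb : Bornology.IsBounded U) {w : E2 → ℝ} (hw : Measurable w) {M : ℝ} (hM : ∀ x, |w x| ≤ M) :
    (∀ x ∈ U, HasFDerivAt (fun x => ∫ y in K, w y * log ‖x - y‖)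
      (∫ y in K, w y • logGrad (x - y)) x) ∧
    ContinuousOn (fun x => ∫ y in K, w y • logGrad (x - y)) U := by
  have hM0 : 0 ≤ M := (abs_nonneg _).trans (hM 0)
  obtain ⟨R, hR⟩ := exists_forall_sub_mem_ball hUb hK.isBounded
  have hfin : IsFiniteMeasure (volume.restrict K) := ⟨by simpa using hK.measure_lt_top⟩
  let ε : ℕ → ℝ := fun n => 1 / ((n : ℝ) + 1)
  have hε : ∀ n, 0 < ε n := fun n => by positivity
  have hregint : ∀ n x, IntegrableOn (fun y => w y • logGradReg (ε n) (x - y)) K := fun n x =>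
    integrableOn_bdd_smul_comp_sub hw hM <|
      ((continuous_logGradReg (hε n)).comp (by fun_prop)).continuousOn.integrableOn_compact hK
  have hlogregc : ∀ n, Continuous fun z : E2 => 1 / 2 * log (‖z‖ ^ 2 + ε n ^ 2) := fun n =>
    continuous_iff_continuousAt.2 fun z => (hasFDerivAt_log_reg (hε n) z).continuousAt
  have hlogregint : ∀ n x, IntegrableOn
      (fun y => w y * (1 / 2 * log (‖x - y‖ ^ 2 + ε n ^ 2))) K := fun n x =>
    integrableOn_bdd_smul_comp_sub hw hM (q := fun z => 1 / 2 * log (‖z‖ ^ 2 + ε n ^ 2)) <|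
      ((hlogregc n).comp (by fun_prop)).continuousOn.integrableOn_compact hK
  have hreg : ∀ n x, HasFDerivAt (fun x => ∫ y in K, w y * (1 / 2 * log (‖x - y‖ ^ 2 + ε n ^ 2)))
      (∫ y in K, w y • logGradReg (ε n) (x - y)) x := by
    intro n x
    refine hasFDerivAt_integral_of_dominated_of_fderiv_le
      (F := fun x y => w y * (1 / 2 * log (‖x - y‖ ^ 2 + ε n ^ 2)))
      (F' := fun x y => w y • logGradReg (ε n) (x - y)) (bound := fun _ => M * (ε n)⁻¹)
      univ_mem (.of_forall fun x => (hlogregint n x).aestronglyMeasurable) (hlogregint n x)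
      (hregint n x).aestronglyMeasurable (.of_forall fun y x _ => ?_) (integrable_const _)
      (.of_forall fun y x _ => ?_)
    · rw [norm_smul]
      exact mul_le_mul (hM y) (norm_logGradReg_le (hε n) _) (norm_nonneg _) hM0
    · exact ((hasFDerivAt_log_reg (hε n) (x - y)).comp x
        ((hasFDerivAt_id x).sub_const y)).const_mul (w y)
  have hregc : ∀ n, Continuous fun x => ∫ y in K, w y • logGradReg (ε n) (x - y) := by
    intro n
    refine continuous_of_dominated (bound := fun _ => M * (ε n)⁻¹)
      (fun x => (hregint n x).aestronglyMeasurable) (fun x => .of_forall fun y => ?_)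
      (integrable_const _) (.of_forall fun y => ?_)
    · rw [norm_smul]
      exact mul_le_mul (hM y) (norm_logGradReg_le (hε n) _) (norm_nonneg _) hM0
    · exact ((continuous_logGradReg (hε n)).comp (by fun_prop)).const_smul (w y)
  have hunif : TendstoUniformlyOn (fun n x => ∫ y in K, w y • logGradReg (ε n) (x - y))
      (fun x => ∫ y in K, w y • logGrad (x - y)) atTop U := by
    rw [Metric.tendstoUniformlyOn_iff]
    intro e he
    have ht := (tendsto_integral_logGradReg_sub R).const_mul M
    rw [mul_zero] at ht
    filter_upwards [ht.eventually (gt_mem_nhds he)] with n hn x hx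
    refine lt_of_le_of_lt ?_ hn
    rw [dist_comm, dist_eq_norm, ← integral_sub (hregint n x)
      (integrableOn_bdd_smul_comp_sub hw hM (integrableOn_comp_sub (integrableOn_logGrad R) (hR x hx)))]
    refine norm_setIntegral_le_of_kernel hM0 (fun z => by positivity) (x := x)
      (q := fun z => (ε n) ^ 2 * (‖z‖ ^ 2 + (ε n) ^ 2)⁻¹ * ‖z‖⁻¹) ?_ (hR x hx)
      (.of_forall fun y => ?_)
    · refine (integrableOn_inv_norm R).mono' (by fun_prop) (.of_forall fun z => ?_)
      rw [norm_of_nonneg (by positivity)]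
      refine mul_le_of_le_one_left (by positivity) ?_
      rw [← div_eq_mul_inv, div_le_one (by have := hε n; positivity)]
      nlinarith [sq_nonneg ‖z‖]
    · refine (norm_smul_sub_smul _ _ _).trans_le ?_
      exact mul_le_mul (hM y) (norm_logGradReg_sub_le _ _) (norm_nonneg _) hM0
  have hpt : ∀ x ∈ U, Tendsto
      (fun n => ∫ y in K, w y * (1 / 2 * log (‖x - y‖ ^ 2 + ε n ^ 2))) atTop
      (𝓝 (∫ y in K, w y * log ‖x - y‖)) := by
    intro x hx
    rw [tendsto_iff_norm_sub_tendsto_zero]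
    have ht : Tendsto (fun n => M * ∫ z in ball (0 : E2) R, ε n * ‖z‖⁻¹) atTop (𝓝 0) := by
      simp only [integral_const_mul]
      simpa [ε] using ((tendsto_one_div_add_atTop_nhds_zero_nat (𝕜 := ℝ)).mul_const
        (∫ z in ball (0 : E2) R, ‖z‖⁻¹)).const_mul M
    have hlogint : IntegrableOn (fun y => w y * log ‖x - y‖) K :=
      integrableOn_bdd_smul_comp_sub hw hM (q := fun z : E2 => log ‖z‖)
        (integrableOn_comp_sub (integrableOn_log_norm R) (hR x hx))
    refine squeeze_zero (fun n => norm_nonneg _) (fun n => ?_) ht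
    rw [← integral_sub (hlogregint n x) hlogint]
    refine norm_setIntegral_le_of_kernel hM0 (x := x) (q := fun z => ε n * ‖z‖⁻¹)
      (fun z => mul_nonneg (hε n).le (by positivity))
      ((integrableOn_inv_norm R).const_mul _) (hR x hx) ?_
    filter_upwards [ae_restrict_of_ae (Measure.ae_ne volume x)] with y hy
    rw [← mul_sub, norm_mul]
    exact mul_le_mul (hM y) (abs_log_reg_sub_le (hε n) (sub_ne_zero.2 hy.symm)) (norm_nonneg _) hM0
  exact ⟨fun x hx => hasFDerivAt_of_tendstoUniformlyOn hU hunif (fun n x _ => hreg n x) hpt hx,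
    hunif.continuousOn (.of_forall fun n => (hregc n).continuousOn)⟩

/-- The derivative of a kernel in its first variable. -/
def fderivFst (k : E2 × E2 → ℝ) (x y : E2) : E2 →L[ℝ] ℝ :=
  (fderiv ℝ k (x, y)).comp (ContinuousLinearMap.inl ℝ E2 E2)

/-- The gradient in `x` of the kernel `-(1/2π) log |x - y| - k (x, y)`. -/
def greenGrad (k : E2 × E2 → ℝ) (x y : E2) : E2 →L[ℝ] ℝ :=
  -(1 / (2 * π)) • logGrad (x - y) - fderivFst k x y

lemma continuous_fderivFst {k : E2 × E2 → ℝ} (hk : ContDiff ℝ 1 k) :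
    Continuous fun p : E2 × E2 => fderivFst k p.1 p.2 :=
  (hk.continuous_fderiv one_ne_zero).clm_comp continuous_const

lemma hasFDerivAt_kernel_fst {k : E2 × E2 → ℝ} (hk : ContDiff ℝ 1 k) (x y : E2) :
    HasFDerivAt (fun x => k (x, y)) (fderivFst k x y) x := by
  have h1 := (hk.differentiable one_ne_zero (x, y)).hasFDerivAt
  exact h1.comp x (hasFDerivAt_prodMk_left x y)

lemma integrableOn_smul_fderivFst {k : E2 × E2 → ℝ} (hk : ContDiff ℝ 1 k) {K : Set E2}
    (hK : IsCompact K) {w : E2 → ℝ} (hw : Measurable w) {M : ℝ} (hM : ∀ x, |w x| ≤ M) (x : E2) :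
    IntegrableOn (fun y => w y • fderivFst k x y) K :=
  Integrable.bdd_smul (((continuous_fderivFst hk).comp
    (by fun_prop : Continuous fun y : E2 => (x, y))).continuousOn.integrableOn_compact hK) M
    hw.aestronglyMeasurable (.of_forall hM)

lemma hasFDerivAt_smoothPotential {k : E2 × E2 → ℝ} (hk : ContDiff ℝ 1 k) {K : Set E2}
    (hK : IsCompact K) {w : E2 → ℝ} (hw : Measurable w) {M : ℝ} (hM : ∀ x, |w x| ≤ M) :
    (∀ x, HasFDerivAt (fun x => ∫ y in K, w y * k (x, y)) (∫ y in K, w y • fderivFst k x y) x) ∧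
    Continuous fun x => ∫ y in K, w y • fderivFst k x y := by
  have hM0 : 0 ≤ M := (abs_nonneg _).trans (hM 0)
  have hfin : IsFiniteMeasure (volume.restrict K) := ⟨by simpa using hK.measure_lt_top⟩
  have hbd : ∀ x₀ : E2, ∃ B, ∀ x ∈ closedBall x₀ 1, ∀ y ∈ K, ‖fderivFst k x y‖ ≤ B := by
    intro x₀
    obtain ⟨B, hB⟩ := ((isCompact_closedBall x₀ 1).prod hK).exists_bound_of_continuousOn
      (continuous_fderivFst hk).continuousOn
    exact ⟨B, fun x hx y hy => hB (x, y) ⟨hx, hy⟩⟩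
  have hint : ∀ x, IntegrableOn (fun y => w y * k (x, y)) K := fun x =>
    Integrable.bdd_mul ((hk.continuous.comp
      (by fun_prop : Continuous fun y : E2 => (x, y))).continuousOn.integrableOn_compact hK)
      hw.aestronglyMeasurable (.of_forall hM)
  have hae : ∀ᵐ y ∂(volume.restrict K), y ∈ K := ae_restrict_mem hK.measurableSet
  constructor
  · intro x
    obtain ⟨B, hB⟩ := hbd x
    refine hasFDerivAt_integral_of_dominated_of_fderiv_le
      (F := fun x y => w y * k (x, y)) (F' := fun x y => w y • fderivFst k x y)
      (bound := fun _ => M * B) (closedBall_mem_nhds x one_pos)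
      (.of_forall fun x => (hint x).aestronglyMeasurable) (hint x)
      (integrableOn_smul_fderivFst hk hK hw hM x).aestronglyMeasurable
      (hae.mono fun y hy x hx => ?_) (integrable_const _) (.of_forall fun y x _ => ?_)
    · rw [norm_smul]
      exact mul_le_mul (hM y) (hB x hx y hy) (norm_nonneg _) hM0
    · exact (hasFDerivAt_kernel_fst hk x y).const_mul (w y)
  · refine continuous_iff_continuousAt.2 fun x => ?_
    obtain ⟨B, hB⟩ := hbd x
    refine continuousAt_of_dominated (bound := fun _ => M * B)
      (.of_forall fun x => (integrableOn_smul_fderivFst hk hK hw hM x).aestronglyMeasurable)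
      ?_ (integrable_const _) (.of_forall fun y => ?_)
    · filter_upwards [closedBall_mem_nhds x one_pos] with x hx
      filter_upwards [hae] with y hy
      rw [norm_smul]
      exact mul_le_mul (hM y) (hB x hx y hy) (norm_nonneg _) hM0
    · exact (((continuous_fderivFst hk).comp
        (by fun_prop : Continuous fun x : E2 => (x, y))).const_smul (w y)).continuousAt

lemma integrableOn_smul_logGrad {K : Set E2} (hK : IsCompact K)
    {w : E2 → ℝ} (hw : Measurable w) {M : ℝ} (hM : ∀ x, |w x| ≤ M) (x : E2) :
    IntegrableOn (fun y => w y • logGrad (x - y)) K := by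
  obtain ⟨R, hR⟩ := exists_forall_sub_mem_ball (Bornology.isBounded_singleton (x := x)) hK.isBounded
  exact integrableOn_bdd_smul_comp_sub hw hM (integrableOn_comp_sub (integrableOn_logGrad R) (hR x rfl))

lemma integral_smul_lincomb {F : Type*} [NormedAddCommGroup F] [NormedSpace ℝ F]
    {α : Type*} [MeasurableSpace α] {μ : Measure α} {w : α → ℝ} {a b : α → F} (c : ℝ)
    (ha : Integrable (fun y => w y • a y) μ) (hb : Integrable (fun y => w y • b y) μ) :
    Integrable (fun y => w y • (c • a y - b y)) μ ∧
    ∫ y, w y • (c • a y - b y) ∂μ = c • ∫ y, w y • a y ∂μ - ∫ y, w y • b y ∂μ := by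
  have h : (fun y => w y • (c • a y - b y)) = fun y => c • (w y • a y) - w y • b y := by
    funext y; rw [smul_sub, smul_comm]
  rw [h, ← integral_smul]
  exact ⟨(ha.smul c).sub hb, integral_sub (ha.smul c) hb⟩

lemma ContinuousOn.const_smul_sub {F X : Type*} [NormedAddCommGroup F] [NormedSpace ℝ F]
    [TopologicalSpace X] {s : Set X} {a b : X → F} (ha : ContinuousOn a s) (c : ℝ)
    (hb : ContinuousOn b s) : ContinuousOn (fun x => c • a x - b x) s :=
  (ha.const_smul c).sub hb

lemma integrableOn_smul_greenGrad {k : E2 × E2 → ℝ} (hk : ContDiff ℝ 1 k) {K : Set E2}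
    (hK : IsCompact K) {w : E2 → ℝ} (hw : Measurable w) {M : ℝ} (hM : ∀ x, |w x| ≤ M) (x : E2) :
    IntegrableOn (fun y => w y • greenGrad k x y) K :=
  (integral_smul_lincomb _ (integrableOn_smul_logGrad hK hw hM x)
    (integrableOn_smul_fderivFst hk hK hw hM x)).1

/-- Differentiability of the potential of a bounded density supported in `K`, on an open set where
the regular part of the kernel is given by `k`. -/
lemma hasFDerivAt_potential {k : E2 × E2 → ℝ} (hk : ContDiff ℝ 1 k) {D K U : Set E2}
    (hD : IsOpen D) (hK : IsCompact K) (hKD : K ⊆ D) (hU : IsOpen U) (hUb : Bornology.IsBounded U)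
    {w : E2 → ℝ} (hw : Measurable w) {M : ℝ} (hM : ∀ x, |w x| ≤ M) (hwK : Function.support w ⊆ K)
    {G : E2 → E2 → ℝ}
    (hG : ∀ x ∈ U, ∀ y ∈ K, G x y = -(1 / (2 * π)) * log ‖x - y‖ - k (x, y))
    {ψ : E2 → ℝ} (hψ : ∀ x, ψ x = ∫ y in D, G x y * w y) :
    (∀ x ∈ U, HasFDerivAt ψ (∫ y in K, w y • greenGrad k x y) x) ∧
    ContinuousOn (fun x => ∫ y in K, w y • greenGrad k x y) U := by
  obtain ⟨h1, h1c⟩ := hasFDerivAt_logPotential hK hU hUb hw hM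
  obtain ⟨h2, h2c⟩ := hasFDerivAt_smoothPotential hk hK hw hM
  have hsplit : (fun x => ∫ y in K, w y • greenGrad k x y) =
      fun x => -(1 / (2 * π)) • (∫ y in K, w y • logGrad (x - y)) -
        ∫ y in K, w y • fderivFst k x y := funext fun x =>
    (integral_smul_lincomb _ (integrableOn_smul_logGrad hK hw hM x)
      (integrableOn_smul_fderivFst hk hK hw hM x)).2
  refine ⟨fun x hx => ?_, ?_⟩
  · rw [congrFun hsplit x]
    refine (((h1 x hx).const_smul (-(1 / (2 * π)))).sub (h2 x)).congr_of_eventuallyEq ?_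
    filter_upwards [hU.mem_nhds hx] with x hx
    have hDK : ψ x = ∫ y in K, G x y * w y := by
      rw [hψ]
      refine setIntegral_eq_of_subset_of_forall_sdiff_eq_zero hD.measurableSet hKD fun y hy => ?_
      rw [Function.notMem_support.1 fun h => hy.2 (hwK h), mul_zero]
    rw [hDK, setIntegral_congr_fun (g := fun y => w y • (-(1 / (2 * π)) • log ‖x - y‖ - k (x, y)))
      hK.measurableSet fun y hy => by simp only [hG x hx y hy, smul_eq_mul]; ring]
    obtain ⟨R, hR⟩ := exists_forall_sub_mem_ball hUb hK.isBounded
    refine (integral_smul_lincomb _ ?_ ?_).2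
    · exact integrableOn_bdd_smul_comp_sub hw hM (q := fun z : E2 => log ‖z‖)
        (integrableOn_comp_sub (integrableOn_log_norm R) (hR x hx))
    · exact Integrable.bdd_mul ((hk.continuous.comp
        (by fun_prop : Continuous fun y : E2 => (x, y))).continuousOn.integrableOn_compact hK)
        hw.aestronglyMeasurable (.of_forall hM)
  · rw [hsplit]
    exact h1c.const_smul_sub _ h2c.continuousOn

lemma fderiv_symm_kernel {k : E2 × E2 → ℝ} (hk : ContDiff ℝ 1 k) (hs : ∀ p, k p.swap = k p)
    (a b u v : E2) : fderiv ℝ k (a, b) (u, v) = fderivFst k a b u + fderivFst k b a v := by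
  have h1 := (hk.differentiable one_ne_zero (b, a)).hasFDerivAt
  have h2 : HasFDerivAt k ((fderiv ℝ k (b, a)).comp
      (ContinuousLinearEquiv.prodComm ℝ E2 E2 : E2 × E2 →L[ℝ] E2 × E2)) (a, b) := by
    have h3 : HasFDerivAt (fun p : E2 × E2 => p.swap)
      (ContinuousLinearEquiv.prodComm ℝ E2 E2 : E2 × E2 →L[ℝ] E2 × E2) (a, b) :=
      (ContinuousLinearEquiv.prodComm ℝ E2 E2).hasFDerivAt
    exact (HasFDerivAt.comp (a, b) h1 h3).congr_of_eventuallyEq (.of_forall fun p => (hs p).symm)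
  have h4 : fderiv ℝ k (a, b) (0, v) = fderiv ℝ k (b, a) (v, 0) := by
    rw [h2.fderiv]; rfl
  have h5 : (u, v) = ((u, 0) : E2 × E2) + (0, v) := by simp
  rw [h5, map_add, h4]
  rfl

/-- The kernel `-(1/2π) log |x - y| - k (x, y)` on pairs of points. -/
def pairKernel (k : E2 × E2 → ℝ) (p : E2 × E2) : ℝ :=
  -(1 / (2 * π)) * log ‖p.1 - p.2‖ - k p

/-- The derivative of `pairKernel` when both points move with velocity field `V`. -/
def pairDeriv (k : E2 × E2 → ℝ) (V : E2 → E2) (p : E2 × E2) : ℝ :=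
  greenGrad k p.1 p.2 (V p.1) + greenGrad k p.2 p.1 (V p.2)

lemma pairDeriv_eq {k : E2 × E2 → ℝ} (hk : ContDiff ℝ 1 k) (hs : ∀ p, k p.swap = k p)
    (V : E2 → E2) (p : E2 × E2) : pairDeriv k V p =
      -(1 / (2 * π)) * logGrad (p.1 - p.2) (V p.1 - V p.2) - fderiv ℝ k p (V p.1, V p.2) := by
  have h1 := fderiv_symm_kernel hk hs p.1 p.2 (V p.1) (V p.2)
  have h2 : logGrad (p.2 - p.1) = -logGrad (p.1 - p.2) := by rw [← logGrad_neg, neg_sub]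
  have h3 : ∀ (c : ℝ) (A B : E2 →L[ℝ] ℝ) (v : E2), (c • A - B) v = c * A v - B v :=
    fun _ _ _ _ => rfl
  rw [Prod.mk.eta] at h1
  rw [h1, pairDeriv, greenGrad, greenGrad, h2, h3, h3, map_sub, neg_apply]
  ring

lemma hasDerivAt_pairKernel {k : E2 × E2 → ℝ} (hk : ContDiff ℝ 1 k) (hs : ∀ p, k p.swap = k p)
    {V : E2 → E2} {L : NNReal} (hV : LipschitzWith L V) {Φ : ℝ → E2 → E2} (hΦ0 : ∀ x, Φ 0 x = x)
    (hΦ : ∀ x t, HasDerivAt (fun s => Φ s x) (V (Φ t x)) t) (x y : E2) (t : ℝ) :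
    HasDerivAt (fun s => pairKernel k (Φ s x, Φ s y)) (pairDeriv k V (Φ t x, Φ t y)) t := by
  rw [pairDeriv_eq hk hs]
  refine HasDerivAt.sub (HasDerivAt.const_mul _ ?_) ?_
  · rcases eq_or_ne x y with rfl | hxy
    · simpa using hasDerivAt_const t (0 : ℝ)
    · have hne : Φ t x - Φ t y ≠ 0 := fun h => hxy <| by
        rw [← flow_neg_apply hV hΦ0 hΦ t x, sub_eq_zero.1 h, flow_neg_apply hV hΦ0 hΦ]
      exact (hasFDerivAt_log_norm hne).comp_hasDerivAt t ((hΦ x t).sub (hΦ y t))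
  · exact (hk.differentiable one_ne_zero _).hasFDerivAt.comp_hasDerivAt t
      ((hΦ x t).prodMk (hΦ y t))

lemma exists_bound_pairDeriv {k : E2 × E2 → ℝ} (hk : ContDiff ℝ 1 k) (hs : ∀ p, k p.swap = k p)
    {V : E2 → E2} {L : NNReal} (hV : LipschitzWith L V) {S : Set E2} (hS : IsCompact S) :
    ∃ B, ∀ x ∈ S, ∀ y ∈ S, |pairDeriv k V (x, y)| ≤ B := by
  have hc : Continuous fun p : E2 × E2 => fderiv ℝ k p (V p.1, V p.2) :=
    (hk.continuous_fderiv one_ne_zero).clm_apply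
      ((hV.continuous.comp continuous_fst).prodMk (hV.continuous.comp continuous_snd))
  obtain ⟨B, hB⟩ := (hS.prod hS).exists_bound_of_continuousOn hc.continuousOn
  refine ⟨1 / (2 * π) * L + B, fun x hx y hy => ?_⟩
  rw [pairDeriv_eq hk hs]
  have h1 : |logGrad (x - y) (V x - V y)| ≤ L := by
    refine ((logGrad (x - y)).le_opNorm _).trans ?_
    rw [norm_logGrad]
    rcases eq_or_ne x y with rfl | hxy
    · simp
    · have h0 : 0 < ‖x - y‖ := norm_pos_iff.2 (sub_ne_zero.2 hxy)
      rw [inv_mul_le_iff₀ h0, mul_comm]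
      exact hV.norm_sub_le x y
  have h2 := hB (x, y) ⟨hx, hy⟩
  rw [norm_eq_abs] at h2
  have hpi : 0 < 1 / (2 * π) := by positivity
  refine (abs_sub _ _).trans (add_le_add ?_ h2)
  rw [abs_mul, abs_neg, abs_of_pos hpi]
  exact mul_le_mul_of_nonneg_left h1 hpi.le

lemma integrable_pairKernel {k : E2 × E2 → ℝ} (hk : Continuous k) {S : Set E2} (hS : IsCompact S) :
    Integrable (pairKernel k) ((volume.restrict S).prod (volume.restrict S)) := by
  refine Integrable.sub (Integrable.const_mul ?_ _) ?_
  · obtain ⟨R, hR⟩ := exists_forall_sub_mem_ball hS.isBounded hS.isBounded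
    refine ((integrable_inv_norm_sub_prod hS).const_mul (R ^ 2 + 1)).mono'
      (measurable_log.comp (by fun_prop)).aestronglyMeasurable ?_
    rw [Measure.prod_restrict]
    filter_upwards [ae_restrict_mem (hS.measurableSet.prod hS.measurableSet)] with p hp
    exact abs_log_le_div (norm_nonneg _) (mem_ball_zero_iff.1 (hR _ hp.1 _ hp.2)).le
  · rw [Measure.prod_restrict]
    exact hk.continuousOn.integrableOn_compact (hS.prod hS)

lemma integrable_greenGrad_prod {k : E2 × E2 → ℝ} (hk : ContDiff ℝ 1 k) {V : E2 → E2}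
    (hV : Continuous V) {S : Set E2} (hS : IsCompact S) :
    Integrable (fun p : E2 × E2 => greenGrad k p.1 p.2 (V p.1))
      ((volume.restrict S).prod (volume.restrict S)) := by
  have h3 : ∀ p : E2 × E2, greenGrad k p.1 p.2 (V p.1) =
      -(1 / (2 * π)) * logGrad (p.1 - p.2) (V p.1) - fderivFst k p.1 p.2 (V p.1) :=
    fun _ => rfl
  simp only [h3]
  refine Integrable.sub (Integrable.const_mul ?_ _) ?_
  · obtain ⟨B, hB⟩ := hS.exists_bound_of_continuousOn hV.continuousOn
    have hm : Measurable fun p : E2 × E2 => logGrad (p.1 - p.2) (V p.1) := by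
      simp only [logGrad, smul_apply, innerSL_apply_apply, smul_eq_mul]
      have := hV.measurable
      fun_prop
    refine ((integrable_inv_norm_sub_prod hS).mul_const B).mono' hm.aestronglyMeasurable ?_
    rw [Measure.prod_restrict]
    filter_upwards [ae_restrict_mem (hS.measurableSet.prod hS.measurableSet)] with p hp
    refine ((logGrad (p.1 - p.2)).le_opNorm _).trans ?_
    rw [norm_logGrad]
    exact mul_le_mul_of_nonneg_left (hB _ hp.1) (by positivity)
  · rw [Measure.prod_restrict]
    exact ((continuous_fderivFst hk).clm_apply (hV.comp continuous_fst)).continuousOn.integrableOn_compact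
      (hS.prod hS)

lemma integrable_mul_mul_prod {μ : Measure E2} [SFinite μ] {w : E2 → ℝ} (hw : Measurable w)
    {M : ℝ} (hM : ∀ x, |w x| ≤ M) {f : E2 × E2 → ℝ} (hf : Integrable f (μ.prod μ)) :
    Integrable (fun p => w p.1 * w p.2 * f p) (μ.prod μ) := by
  refine Integrable.bdd_mul (c := M * M) hf
    ((hw.comp measurable_fst).mul (hw.comp measurable_snd)).aestronglyMeasurable
    (.of_forall fun p => ?_)
  rw [norm_mul]
  exact mul_le_mul (hM _) (hM _) (norm_nonneg _) ((abs_nonneg _).trans (hM 0))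

lemma integrable_pairDeriv (k : E2 × E2 → ℝ) {V : E2 → E2} (hk : ContDiff ℝ 1 k)
    (hV : Continuous V) {S : Set E2} (hS : IsCompact S) :
    Integrable (pairDeriv k V) ((volume.restrict S).prod (volume.restrict S)) :=
  (integrable_greenGrad_prod hk hV hS).add (integrable_greenGrad_prod hk hV hS).swap

/-- Derivative of the interaction energy of a density transported by a flow that maps the compact
set `S` to itself. -/
lemma hasDerivAt_pairEnergy {k : E2 × E2 → ℝ} (hk : ContDiff ℝ 1 k) (hs : ∀ p, k p.swap = k p)
    {V : E2 → E2} {L : NNReal} (hV : LipschitzWith L V) {Φ : ℝ → E2 → E2} (hΦ0 : ∀ x, Φ 0 x = x)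
    (hΦ : ∀ x t, HasDerivAt (fun s => Φ s x) (V (Φ t x)) t)
    {S : Set E2} (hS : IsCompact S) (hVS : ∀ x ∉ S, V x = 0)
    (hmp : ∀ t, MeasurePreserving (Φ t) volume volume)
    {w : E2 → ℝ} (hw : Measurable w) {M : ℝ} (hM : ∀ x, |w x| ≤ M) :
    (∀ t, Integrable (fun p : E2 × E2 => w p.1 * w p.2 * pairKernel k (Φ t p.1, Φ t p.2))
      ((volume.restrict S).prod (volume.restrict S))) ∧
    HasDerivAt (fun t => ∫ p : E2 × E2, w p.1 * w p.2 * pairKernel k (Φ t p.1, Φ t p.2)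
        ∂((volume.restrict S).prod (volume.restrict S)))
      (2 * ∫ x in S, w x * (∫ y in S, w y • greenGrad k x y) (V x)) 0 := by
  have hfin : IsFiniteMeasure (volume.restrict S) := ⟨by simpa using hS.measure_lt_top⟩
  set ν := (volume.restrict S).prod (volume.restrict S) with hν
  have hmpS : ∀ t, MeasurePreserving (Φ t) (volume.restrict S) (volume.restrict S) := fun t => by
    have := (hmp t).restrict_preimage hS.measurableSet
    rwa [flow_preimage hV hΦ0 hΦ hVS] at this
  have hint : ∀ t, Integrable (fun p : E2 × E2 => w p.1 * w p.2 *
      pairKernel k (Φ t p.1, Φ t p.2)) ν := fun t =>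
    integrable_mul_mul_prod hw hM (((hmpS t).prod (hmpS t)).integrable_comp_of_integrable
      (integrable_pairKernel hk.continuous hS))
  refine ⟨hint, ?_⟩
  obtain ⟨B, hB⟩ := exists_bound_pairDeriv hk hs hV hS
  have hM0 : 0 ≤ M := (abs_nonneg _).trans (hM 0)
  have hae : ∀ᵐ p ∂ν, p ∈ S ×ˢ S := by
    rw [hν, Measure.prod_restrict]
    exact ae_restrict_mem (hS.measurableSet.prod hS.measurableSet)
  have hf := integrable_mul_mul_prod hw hM (integrable_greenGrad_prod hk hV.continuous hS)
  have hQ := integrable_mul_mul_prod hw hM (integrable_pairDeriv k hk hV.continuous hS)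
  have hbound : ∀ᵐ p ∂ν, ∀ t ∈ Set.univ,
      ‖w p.1 * w p.2 * pairDeriv k V (Φ t p.1, Φ t p.2)‖ ≤ M * M * B := by
    refine hae.mono fun p hp t _ => ?_
    rw [norm_mul, norm_mul]
    exact mul_le_mul (mul_le_mul (hM _) (hM _) (norm_nonneg _) hM0)
      (hB _ (flow_mem hV hΦ0 hΦ hVS hp.1 t) _ (flow_mem hV hΦ0 hΦ hVS hp.2 t)) (norm_nonneg _)
      (by positivity)
  have hder := (hasDerivAt_integral_of_dominated_loc_of_deriv_le (μ := ν) (x₀ := (0 : ℝ))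
    (s := Set.univ) (bound := fun _ => M * M * B)
    (F := fun t p => w p.1 * w p.2 * pairKernel k (Φ t p.1, Φ t p.2))
    (F' := fun t p => w p.1 * w p.2 * pairDeriv k V (Φ t p.1, Φ t p.2))
    univ_mem (.of_forall fun t => (hint t).aestronglyMeasurable) (hint 0)
    (by simpa only [hΦ0] using hQ.aestronglyMeasurable)
    hbound (integrable_const _)
    (.of_forall fun p t _ =>
      (hasDerivAt_pairKernel hk hs hV hΦ0 hΦ p.1 p.2 t).const_mul _)).2
  refine hder.congr_deriv ?_
  simp only [hΦ0, pairDeriv, mul_add]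
  have hswap : ∫ p, w p.1 * w p.2 * greenGrad k p.2 p.1 (V p.2) ∂ν =
      ∫ p, w p.1 * w p.2 * greenGrad k p.1 p.2 (V p.1) ∂ν := by
    rw [hν, ← integral_prod_swap]
    simp only [Prod.fst_swap, Prod.snd_swap, mul_comm (w _) (w _)]
  have hf' : Integrable (fun p => w p.1 * w p.2 * greenGrad k p.2 p.1 (V p.2)) ν := by
    simpa only [Function.comp_def, Prod.fst_swap, Prod.snd_swap, mul_comm (w _) (w _)]
      using hf.swap
  rw [integral_add hf hf', hswap, ← two_mul, integral_prod _ hf]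
  congr 1
  refine integral_congr_ae (.of_forall fun x => ?_)
  simp only
  rw [ContinuousLinearMap.integral_apply (integrableOn_smul_greenGrad hk hS hw hM x),
    ← integral_const_mul]
  refine integral_congr_ae (.of_forall fun y => ?_)
  simp [mul_assoc]

lemma setIntegral_mul_transport {V : E2 → E2} {L : NNReal} (hV : LipschitzWith L V)
    {Φ : ℝ → E2 → E2} (hΦ0 : ∀ x, Φ 0 x = x)
    (hΦ : ∀ x t, HasDerivAt (fun s => Φ s x) (V (Φ t x)) t)
    {D S : Set E2} (hD : IsOpen D) (hSD : S ⊆ D) (hVS : ∀ x ∉ S, V x = 0)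
    (hmp : ∀ t, MeasurePreserving (Φ t) volume volume)
    {w : E2 → ℝ} (hwS : Function.support w ⊆ S) (F : E2 → ℝ) (t : ℝ) :
    ∫ x in D, F x * w (Φ (-t) x) = ∫ x in S, F (Φ t x) * w x := by
  have hpre := fun t => flow_preimage hV hΦ0 hΦ hVS (t := t)
  rw [setIntegral_eq_of_subset_of_forall_sdiff_eq_zero hD.measurableSet hSD fun x hx => ?_]
  · have he : MeasurableEmbedding (Φ t) :=
      (flowHomeomorph hV hΦ0 hΦ t).measurableEmbedding
    have h := (hmp t).setIntegral_preimage_emb he (fun x => F x * w (Φ (-t) x)) S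
    rw [hpre t] at h
    simpa only [flow_neg_apply hV hΦ0 hΦ] using h.symm
  · have hx' : Φ (-t) x ∉ S := fun h => hx.2 (by rw [← hpre (-t)]; exact h)
    rw [Function.notMem_support.1 fun h => hx' (hwS h), mul_zero]

lemma fderiv_hamVF_eq_jac (ψ φ : E2 → ℝ) (x : E2) : fderiv ℝ ψ x (hamVF φ x) = jac ψ φ x := by
  rw [apply_hamVF]
  rfl

theorem first_variation_of_energy
    (D : Set E2) (hDopen : IsOpen D) (hDbdd : Bornology.IsBounded D)
    (hDsc : SimplyConnectedSpace D)
    (h : E2 → E2 → ℝ)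
    (hcont : ContinuousOn (fun q : E2 × E2 => h q.1 q.2) (D ×ˢ D))
    (hsymm : ∀ x ∈ D, ∀ y ∈ D, h x y = h y x)
    (hharm : ∀ y ∈ D, ContDiffOn ℝ 2 (fun x => h x y) D ∧
      ∀ x ∈ D, ∑ i : Fin 2,
        iteratedFDerivWithin ℝ 2 (fun x' => h x' y) D x
          ![EuclideanSpace.single i 1, EuclideanSpace.single i 1] = 0)
    (G : E2 → E2 → ℝ)
    (hG : ∀ x y, G x y = (1 / (2 * π)) * Real.log (1 / dist x y) - h x y)
    (hGbdry : ∀ y ∈ D, ∀ z ∈ frontier D,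
      Tendsto (fun x => G x y) (𝓝[D] z) (𝓝 0))
    -- ω ∈ L^∞(D) with essential support compactly contained in D
    (ω : E2 → ℝ) (hωmeas : Measurable ω)
    (M : ℝ) (hωbdd : ∀ x, |ω x| ≤ M)
    (K : Set E2) (hK : IsCompact K) (hKD : K ⊆ D)
    (hωsupp : Function.support ω ⊆ K)
    -- φ ∈ C_c^∞(D)
    (φ : E2 → ℝ) (hφ : ContDiff ℝ (⊤ : ℕ∞) φ) (hφsupp : HasCompactSupport φ)
    (hφD : tsupport φ ⊆ D)
    -- Φ is the flow of the vector field J∇φ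
    (Φ : ℝ → E2 → E2)
    (hΦ0 : ∀ x : E2, Φ 0 x = x)
    (hΦode : ∀ x : E2, ∀ t : ℝ, HasDerivAt (fun s => Φ s x) (hamVF φ (Φ t x)) t)
    -- the stream function ψ of ω
    (ψ : E2 → ℝ) (hψ : ∀ x, ψ x = ∫ y in D, G x y * ω y) :
    ContDiffOn ℝ 1 ψ D ∧
    HasDerivAt
      (fun t => (1 / 2) * ∫ x in D, ∫ y in D, G x y * ω (Φ (-t) x) * ω (Φ (-t) y))
      (∫ x in D, ω x * jac ψ φ x) 0 := by
  set S := K ∪ tsupport φ with hSdef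
  have hS : IsCompact S := hK.union hφsupp.isCompact
  have hSD : S ⊆ D := Set.union_subset hKD hφD
  have hωS : Function.support ω ⊆ S := hωsupp.trans Set.subset_union_left
  have hVS : ∀ x ∉ S, hamVF φ x = 0 := fun x hx => hamVF_eq_zero fun hx' => hx (.inr hx')
  obtain ⟨L, hV⟩ := exists_lipschitzWith_hamVF hφ hφsupp
  have hmp := measurePreserving_flow hφ hφsupp hΦ0 hΦode
  have hkernel : ∀ C : Set E2, IsCompact C → C ⊆ D → S ⊆ C → ∃ k : E2 × E2 → ℝ,
      ContDiff ℝ 1 k ∧ (∀ p, k p.swap = k p) ∧ ∀ x ∈ C, ∀ y ∈ C, G x y = pairKernel k (x, y) := by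
    intro C hC hCD hSC
    obtain ⟨k, hk, hks, hkh⟩ := exists_contDiff_symm_kernel hDopen hcont hsymm hharm hC hCD
    refine ⟨k, hk, hks, fun x hx y hy => ?_⟩
    rw [hG, pairKernel, hkh x hx y hy, one_div (dist x y), log_inv, dist_eq_norm]
    ring
  have hderiv : ∀ (C : Set E2) (k : E2 × E2 → ℝ), IsCompact C → ContDiff ℝ 1 k → S ⊆ C →
      (∀ x ∈ C, ∀ y ∈ C, G x y = pairKernel k (x, y)) →
      (∀ x ∈ interior C, HasFDerivAt ψ (∫ y in S, ω y • greenGrad k x y) x) ∧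
      ContinuousOn (fun x => ∫ y in S, ω y • greenGrad k x y) (interior C) := fun C k hC hk hSC hGk =>
    hasFDerivAt_potential hk hDopen hS hSD isOpen_interior (hC.isBounded.subset interior_subset)
      hωmeas hωbdd hωS (fun x hx y hy => hGk x (interior_subset hx) y (hSC hy)) hψ
  constructor
  · intro x hx
    obtain ⟨C₀, hC₀, hxC₀, hC₀D⟩ := exists_compact_subset hDopen hx
    have hC := hC₀.union hS
    obtain ⟨k, hk, -, hGk⟩ := hkernel _ hC (Set.union_subset hC₀D hSD) Set.subset_union_right
    obtain ⟨h1, h2⟩ := hderiv _ k hC hk Set.subset_union_right hGk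
    have hxi : interior (C₀ ∪ S) ∈ 𝓝 x :=
      isOpen_interior.mem_nhds (interior_mono Set.subset_union_left hxC₀)
    refine ContDiffAt.contDiffWithinAt (contDiffAt_one_iff.2 ⟨_, _, hxi, h2, h1⟩)
  · obtain ⟨C, hC, hSC, hCD⟩ := exists_compact_between hS hDopen hSD
    obtain ⟨k, hk, hks, hGk⟩ := hkernel C hC hCD (hSC.trans interior_subset)
    obtain ⟨h1, -⟩ := hderiv C k hC hk (hSC.trans interior_subset) hGk
    obtain ⟨hint, hE⟩ := hasDerivAt_pairEnergy hk hks hV hΦ0 hΦode hS hVS hmp hωmeas hωbdd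
    have hval : ∫ x in D, ω x * jac ψ φ x =
        1 / 2 * (2 * ∫ x in S, ω x * (∫ y in S, ω y • greenGrad k x y) (hamVF φ x)) := by
      rw [← mul_assoc, one_div, inv_mul_cancel₀ two_ne_zero, one_mul,
        setIntegral_eq_of_subset_of_forall_sdiff_eq_zero hDopen.measurableSet hSD fun x hx => by
          rw [Function.notMem_support.1 fun h => hx.2 (hωS h), zero_mul]]
      refine setIntegral_congr_fun hS.measurableSet fun x hx => ?_
      rw [← (h1 x (hSC hx)).fderiv, fderiv_hamVF_eq_jac]
    rw [hval]
    refine (hE.const_mul (1 / 2)).congr_of_eventuallyEq (.of_forall fun t => ?_)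
    have htr := fun F => setIntegral_mul_transport hV hΦ0 hΦode hDopen hSD hVS hmp hωS F t
    have hinner : ∀ x, ∫ y in D, G x y * ω (Φ (-t) x) * ω (Φ (-t) y) =
        (∫ y in S, G x (Φ t y) * ω y) * ω (Φ (-t) x) := fun x => by
      rw [htr fun y => G x y * ω (Φ (-t) x), ← integral_mul_const]
      simp only [mul_right_comm]
    simp only [hinner]
    rw [htr fun x => ∫ y in S, G x (Φ t y) * ω y, integral_prod _ (hint t)]
    congr 1
    refine setIntegral_congr_fun hS.measurableSet fun x hx => ?_
    simp only
    rw [← integral_mul_const]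
    refine setIntegral_congr_fun hS.measurableSet fun y hy => ?_
    have hmem : ∀ z ∈ S, Φ t z ∈ C := fun z hz =>
      interior_subset (hSC (flow_mem hV hΦ0 hΦode hVS hz t))
    rw [hGk _ (hmem x hx) _ (hmem y hy)]
    ring
end
end
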